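/- arXiv:1509.03230 — 5 statements merged into one kernel-verified Lean document; each statement's English description precedes it below -/
import Mathlib

section
/- Let Q = {(x, y) ∈ ℝ² : x ≥ 0, y ≥ 0}, let H = {f↾Q : f ∈ A_2}, and let G be the set of functions l : Q → ℝ of the form l = m + f with m ∈ ℤ a constant and f ∈ H, equipped with pointwise addition and with the lexicographic lattice order: l ≤ l' iff l(0,0) < l'(0,0), or l(0,0) = l'(0,0) and l(p) ≤ l'(p) for all p ∈ Q. Then (G, 1) (with unit the constant function 1) is a unital ℓ-group which is not hopfian: the map σ(l) = l ∘ q, where q(x, y) = (x, x + y), is a surjective unital ℓ-endomorphism of (G, 1) whose kernel contains the nonzero function k(x, y) = max(x − y, 0). (Via the Γ functor this is the statement that the free product C ⨿ C of two copies of Chang's MV-algebra is not hopfian.) -/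
open Set

/-- The first quadrant `Q = {(x,y) : x ≥ 0, y ≥ 0}` of `ℝ²`. -/
def Qset : Set (ℝ × ℝ) := {p : ℝ × ℝ | 0 ≤ p.1 ∧ 0 ≤ p.2}

/-- A homogeneous linear polynomial on `ℝ²` with integer coefficients. -/
def IsHomLinZ2 (p : ℝ × ℝ → ℝ) : Prop :=
  ∃ a b : ℤ, ∀ v : ℝ × ℝ, p v = (a : ℝ) * v.1 + (b : ℝ) * v.2

/-- The free two-generator ℓ-group `A₂`: continuous piecewise homogeneous linear
functions on `ℝ²` with integer coefficients. -/
def A2 : Set (ℝ × ℝ → ℝ) :=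
  {f : ℝ × ℝ → ℝ | Continuous f ∧ ∃ (u : ℕ) (p : Fin u → ℝ × ℝ → ℝ),
    (∀ j, IsHomLinZ2 (p j)) ∧ ∀ v : ℝ × ℝ, ∃ j, f v = p j v}

/-- The map `q(x,y) = (x, x+y)`, viewed as a map of the quadrant `Q` into itself. -/
def qmapQ : ↥Qset → ↥Qset :=
  fun v => ⟨(v.1.1, v.1.1 + v.1.2), ⟨v.2.1, add_nonneg v.2.1 v.2.2⟩⟩

/-- `H = A₂↾Q`: restrictions to the quadrant `Q` of elements of `A₂`. -/
def Hset : Set (↥Qset → ℝ) := {g : ↥Qset → ℝ | ∃ f ∈ A2, ∀ v : ↥Qset, g v = f v.1}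

/-- `G = ℤ +_lex H`: functions `m + f` on `Q` with `m ∈ ℤ` and `f ∈ H`. -/
def Gset : Set (↥Qset → ℝ) :=
  {l : ↥Qset → ℝ | ∃ (m : ℤ), ∃ g ∈ Hset, l = fun v => (m : ℝ) + g v}

/-- The origin `(0,0)` as an element of the quadrant `Q`. -/
def originQ : ↥Qset := ⟨(0, 0), ⟨le_refl 0, le_refl 0⟩⟩

/-- The lexicographic order on `G`: `l ≤ l'` iff `l(0,0) < l'(0,0)`, or
`l(0,0) = l'(0,0)` and `l ≤ l'` pointwise. -/
def glex (l l' : ↥Qset → ℝ) : Prop :=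
  l originQ < l' originQ ∨ (l originQ = l' originQ ∧ ∀ v, l v ≤ l' v)

/-- The supremum for the lexicographic order. -/
noncomputable def lexSup (l l' : ↥Qset → ℝ) : ↥Qset → ℝ :=
  if l originQ < l' originQ then l'
  else if l' originQ < l originQ then l
  else fun v => max (l v) (l' v)

/-- The infimum for the lexicographic order. -/
noncomputable def lexInf (l l' : ↥Qset → ℝ) : ↥Qset → ℝ :=
  if l originQ < l' originQ then l
  else if l' originQ < l originQ then l'
  else fun v => min (l v) (l' v)

/-- The index set of the linear pieces of an element of `A2` may be any finite type. -/
theorem mem_A2_of_finite {ι : Type*} [Finite ι] {f : ℝ × ℝ → ℝ} (hf : Continuous f)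
    (p : ι → ℝ × ℝ → ℝ) (hp : ∀ j, IsHomLinZ2 (p j)) (h : ∀ v, ∃ j, f v = p j v) :
    f ∈ A2 := by
  obtain ⟨n, ⟨e⟩⟩ := Finite.exists_equiv_fin ι
  refine ⟨hf, n, fun j => p (e.symm j), fun j => hp _, fun v => ?_⟩
  obtain ⟨j, hj⟩ := h v
  exact ⟨e j, by simpa using hj⟩

theorem linear_mem_A2 (a b : ℤ) : (fun v : ℝ × ℝ => (a : ℝ) * v.1 + (b : ℝ) * v.2) ∈ A2 :=
  mem_A2_of_finite (ι := Unit) (by fun_prop) (fun _ v => (a : ℝ) * v.1 + (b : ℝ) * v.2)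
    (fun _ => ⟨a, b, fun _ => rfl⟩) (fun _ => ⟨(), rfl⟩)

theorem zero_mem_A2 : (fun _ : ℝ × ℝ => (0 : ℝ)) ∈ A2 := by
  simpa using linear_mem_A2 0 0

theorem add_mem_A2 {f g : ℝ × ℝ → ℝ} (hf : f ∈ A2) (hg : g ∈ A2) :
    (fun v => f v + g v) ∈ A2 := by
  obtain ⟨cf, u, p, hp, hfp⟩ := hf
  obtain ⟨cg, w, r, hr, hgr⟩ := hg
  refine mem_A2_of_finite (ι := Fin u × Fin w) (by fun_prop)
    (fun j v => p j.1 v + r j.2 v) (fun j => ?_) (fun v => ?_)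
  · obtain ⟨a, b, hab⟩ := hp j.1
    obtain ⟨c, d, hcd⟩ := hr j.2
    refine ⟨a + c, b + d, fun v => ?_⟩
    simp only [hab, hcd]
    push_cast
    ring
  · obtain ⟨i, hi⟩ := hfp v
    obtain ⟨j, hj⟩ := hgr v
    exact ⟨(i, j), by rw [hi, hj]⟩

theorem neg_mem_A2 {f : ℝ × ℝ → ℝ} (hf : f ∈ A2) : (fun v => -f v) ∈ A2 := by
  obtain ⟨cf, u, p, hp, hfp⟩ := hf
  refine mem_A2_of_finite (by fun_prop) (fun j v => -p j v) (fun j => ?_) (fun v => ?_)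
  · obtain ⟨a, b, hab⟩ := hp j
    refine ⟨-a, -b, fun v => ?_⟩
    simp only [hab]
    push_cast
    ring
  · obtain ⟨i, hi⟩ := hfp v
    exact ⟨i, by rw [hi]⟩

theorem max_mem_A2 {f g : ℝ × ℝ → ℝ} (hf : f ∈ A2) (hg : g ∈ A2) :
    (fun v => max (f v) (g v)) ∈ A2 := by
  obtain ⟨cf, u, p, hp, hfp⟩ := hf
  obtain ⟨cg, w, r, hr, hgr⟩ := hg
  refine mem_A2_of_finite (by fun_prop) (Sum.elim p r) (fun j => ?_) (fun v => ?_)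
  · rcases j with j | j
    · exact hp j
    · exact hr j
  · rcases max_choice (f v) (g v) with h | h
    · obtain ⟨i, hi⟩ := hfp v
      exact ⟨Sum.inl i, h.trans hi⟩
    · obtain ⟨i, hi⟩ := hgr v
      exact ⟨Sum.inr i, h.trans hi⟩

/-- `A2` is stable under integer shears fixing the first coordinate. -/
theorem shear_mem_A2 {f : ℝ × ℝ → ℝ} (hf : f ∈ A2) (k : ℤ) :
    (fun v : ℝ × ℝ => f (v.1, k * v.1 + v.2)) ∈ A2 := by
  obtain ⟨cf, u, p, hp, hfp⟩ := hf
  refine mem_A2_of_finite (by fun_prop) (fun j v => p j (v.1, k * v.1 + v.2))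
    (fun j => ?_) (fun v => hfp _)
  obtain ⟨a, b, hab⟩ := hp j
  refine ⟨a + b * k, b, fun v => ?_⟩
  simp only [hab]
  push_cast
  ring

theorem A2_apply_zero {f : ℝ × ℝ → ℝ} (hf : f ∈ A2) : f (0, 0) = 0 := by
  obtain ⟨-, u, p, hp, hfp⟩ := hf
  obtain ⟨j, hj⟩ := hfp (0, 0)
  obtain ⟨a, b, hab⟩ := hp j
  rw [hj, hab]
  simp

theorem mem_Gset_iff {l : ↥Qset → ℝ} :
    l ∈ Gset ↔ ∃ m : ℤ, ∃ f ∈ A2, ∀ v : ↥Qset, l v = m + f v.1 := by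
  constructor
  · rintro ⟨m, g, ⟨f, hf, hg⟩, rfl⟩
    exact ⟨m, f, hf, fun v => by simp only [hg]⟩
  · rintro ⟨m, f, hf, h⟩
    exact ⟨m, fun v => f v.1, ⟨f, hf, fun _ => rfl⟩, funext h⟩

theorem const_mem_Gset {l : ↥Qset → ℝ} (m : ℤ) (h : ∀ v, l v = m) : l ∈ Gset :=
  mem_Gset_iff.2 ⟨m, _, zero_mem_A2, fun v => by rw [h, add_zero]⟩

theorem add_mem_Gset {l l' : ↥Qset → ℝ} (hl : l ∈ Gset) (hl' : l' ∈ Gset) : l + l' ∈ Gset := by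
  obtain ⟨m, f, hf, h⟩ := mem_Gset_iff.1 hl
  obtain ⟨n, g, hg, h'⟩ := mem_Gset_iff.1 hl'
  refine mem_Gset_iff.2 ⟨m + n, _, add_mem_A2 hf hg, fun v => ?_⟩
  rw [Pi.add_apply, h, h']
  push_cast
  ring

theorem neg_mem_Gset {l : ↥Qset → ℝ} (hl : l ∈ Gset) : -l ∈ Gset := by
  obtain ⟨m, f, hf, h⟩ := mem_Gset_iff.1 hl
  refine mem_Gset_iff.2 ⟨-m, _, neg_mem_A2 hf, fun v => ?_⟩
  rw [Pi.neg_apply, h]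
  push_cast
  ring

theorem max_mem_Gset {l l' : ↥Qset → ℝ} (hl : l ∈ Gset) (hl' : l' ∈ Gset)
    (h0 : l originQ = l' originQ) : (fun v => max (l v) (l' v)) ∈ Gset := by
  obtain ⟨m, f, hf, h⟩ := mem_Gset_iff.1 hl
  obtain ⟨n, g, hg, h'⟩ := mem_Gset_iff.1 hl'
  have hmn : (m : ℝ) = n := by
    have hf0 : f originQ.1 = 0 := A2_apply_zero hf
    have hg0 : g originQ.1 = 0 := A2_apply_zero hg
    rwa [h, h', hf0, hg0, add_zero, add_zero] at h0
  refine mem_Gset_iff.2 ⟨m, _, max_mem_A2 hf hg, fun v => ?_⟩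
  rw [h, h', ← hmn, max_add_add_left]

theorem lexSup_mem_Gset {l l' : ↥Qset → ℝ} (hl : l ∈ Gset) (hl' : l' ∈ Gset) :
    lexSup l l' ∈ Gset := by
  unfold lexSup
  split_ifs with h₁ h₂
  · exact hl'
  · exact hl
  · exact max_mem_Gset hl hl' (le_antisymm (not_lt.1 h₂) (not_lt.1 h₁))

theorem lexInf_eq_neg_lexSup (l l' : ↥Qset → ℝ) : lexInf l l' = -lexSup (-l') (-l) := by
  unfold lexInf lexSup
  simp only [Pi.neg_apply, neg_lt_neg_iff]
  split_ifs
  · simp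
  · simp
  · ext v
    simp [max_neg_neg, min_comm]

theorem glex_neg_neg {l l' : ↥Qset → ℝ} : glex (-l) (-l') ↔ glex l' l := by
  simp [glex, eq_comm]

theorem glex_refl (l : ↥Qset → ℝ) : glex l l := Or.inr ⟨rfl, fun _ => le_rfl⟩

theorem glex_antisymm {l l' : ↥Qset → ℝ} (h : glex l l') (h' : glex l' l) : l = l' := by
  rcases h with h | ⟨h0, h⟩ <;> rcases h' with h' | ⟨h0', h'⟩
  · linarith
  · linarith
  · linarith
  · exact funext fun v => le_antisymm (h v) (h' v)

theorem glex_trans {l l' l'' : ↥Qset → ℝ} (h : glex l l') (h' : glex l' l'') : glex l l'' := by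
  rcases h with h | ⟨h0, h⟩ <;> rcases h' with h' | ⟨h0', h'⟩
  · exact Or.inl (by linarith)
  · exact Or.inl (by linarith)
  · exact Or.inl (by linarith)
  · exact Or.inr ⟨h0.trans h0', fun v => (h v).trans (h' v)⟩

theorem glex_add_right {l l' : ↥Qset → ℝ} (h : glex l l') (k : ↥Qset → ℝ) :
    glex (l + k) (l' + k) := by
  simpa [glex] using h

theorem glex_lexSup_left (l l' : ↥Qset → ℝ) : glex l (lexSup l l') := by
  unfold lexSup
  split_ifs with h₁ h₂
  · exact Or.inl h₁
  · exact glex_refl l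
  · exact Or.inr ⟨(max_eq_left (not_lt.1 h₁)).symm, fun v => le_max_left _ _⟩

theorem glex_lexSup_right (l l' : ↥Qset → ℝ) : glex l' (lexSup l l') := by
  unfold lexSup
  split_ifs with h₁ h₂
  · exact glex_refl l'
  · exact Or.inl h₂
  · exact Or.inr ⟨(max_eq_right (not_lt.1 h₂)).symm, fun v => le_max_right _ _⟩

theorem lexSup_glex {l l' m : ↥Qset → ℝ} (h : glex l m) (h' : glex l' m) :
    glex (lexSup l l') m := by
  unfold lexSup
  split_ifs with h₁ h₂
  · exact h'
  · exact h
  · have h0 : l originQ = l' originQ := le_antisymm (not_lt.1 h₂) (not_lt.1 h₁)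
    rcases h with h | ⟨hm, h⟩ <;> rcases h' with h' | ⟨hm', h'⟩
    · exact Or.inl (max_lt h h')
    · linarith
    · linarith
    · exact Or.inr ⟨by simp only [← h0, max_self, hm], fun v => max_le (h v) (h' v)⟩

theorem qmapQ_originQ : qmapQ originQ = originQ :=
  Subtype.ext (by simp [qmapQ, originQ])

theorem lexSup_comp_qmapQ (l l' : ↥Qset → ℝ) :
    lexSup l l' ∘ qmapQ = lexSup (l ∘ qmapQ) (l' ∘ qmapQ) := by
  unfold lexSup
  simp only [Function.comp_apply, qmapQ_originQ]
  split_ifs <;> rfl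

theorem lexInf_comp_qmapQ (l l' : ↥Qset → ℝ) :
    lexInf l l' ∘ qmapQ = lexInf (l ∘ qmapQ) (l' ∘ qmapQ) := by
  unfold lexInf
  simp only [Function.comp_apply, qmapQ_originQ]
  split_ifs <;> rfl

theorem comp_qmapQ_mem_Gset {l : ↥Qset → ℝ} (hl : l ∈ Gset) : l ∘ qmapQ ∈ Gset := by
  obtain ⟨m, f, hf, h⟩ := mem_Gset_iff.1 hl
  refine mem_Gset_iff.2 ⟨m, _, shear_mem_A2 hf 1, fun v => ?_⟩
  rw [Function.comp_apply, h]
  simp [qmapQ]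

/-- A preimage of `m + f` is `m + f'` with `f' (x, y) = f (x, y - x)`. -/
theorem exists_comp_qmapQ_eq {l : ↥Qset → ℝ} (hl : l ∈ Gset) :
    ∃ l' ∈ Gset, l' ∘ qmapQ = l := by
  obtain ⟨m, f, hf, h⟩ := mem_Gset_iff.1 hl
  refine ⟨fun v => m + f (v.1.1, ((-1 : ℤ) : ℝ) * v.1.1 + v.1.2),
    mem_Gset_iff.2 ⟨m, _, shear_mem_A2 hf (-1), fun v => rfl⟩, funext fun v => ?_⟩
  rw [h]
  simp [qmapQ]

theorem max_sub_zero_mem_Gset : (fun v : ↥Qset => max (v.1.1 - v.1.2) 0) ∈ Gset := by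
  refine mem_Gset_iff.2 ⟨0, _, max_mem_A2 (linear_mem_A2 1 (-1)) zero_mem_A2, fun v => ?_⟩
  simp [sub_eq_add_neg]

theorem max_sub_zero_ne_zero : (fun v : ↥Qset => max (v.1.1 - v.1.2) 0) ≠ (0 : ↥Qset → ℝ) := by
  intro h
  have h1 := congrFun h ⟨(1, 0), ⟨zero_le_one, le_rfl⟩⟩
  norm_num at h1

theorem max_sub_zero_comp_qmapQ :
    (fun v : ↥Qset => max (v.1.1 - v.1.2) 0) ∘ qmapQ = (0 : ↥Qset → ℝ) := by
  ext v
  simpa [qmapQ] using v.2.2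

/-- `(G, 1)` with the lexicographic order is a unital ℓ-group which is not
hopfian: `σ(l) = l ∘ q` with `q(x,y) = (x, x+y)` is a surjective unital ℓ-endomorphism of
`(G, 1)` whose kernel contains the nonzero function `k(x,y) = max (x - y) 0`. -/
theorem stmt15 :
    -- (G, glex, +, lexSup, lexInf, 1) is a unital ℓ-group:
    ((1 : ↥Qset → ℝ) ∈ Gset) ∧ ((0 : ↥Qset → ℝ) ∈ Gset) ∧
    (∀ l ∈ Gset, ∀ l' ∈ Gset, l + l' ∈ Gset) ∧ (∀ l ∈ Gset, -l ∈ Gset) ∧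
    (∀ l ∈ Gset, glex l l) ∧
    (∀ l ∈ Gset, ∀ l' ∈ Gset, glex l l' → glex l' l → l = l') ∧
    (∀ l ∈ Gset, ∀ l' ∈ Gset, ∀ l'' ∈ Gset, glex l l' → glex l' l'' → glex l l'') ∧
    (∀ l ∈ Gset, ∀ l' ∈ Gset, ∀ h ∈ Gset, glex l l' → glex (l + h) (l' + h)) ∧
    (∀ l ∈ Gset, ∀ l' ∈ Gset, lexSup l l' ∈ Gset ∧ glex l (lexSup l l') ∧
      glex l' (lexSup l l') ∧ ∀ m ∈ Gset, glex l m → glex l' m → glex (lexSup l l') m) ∧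
    (∀ l ∈ Gset, ∀ l' ∈ Gset, lexInf l l' ∈ Gset ∧ glex (lexInf l l') l ∧
      glex (lexInf l l') l' ∧ ∀ m ∈ Gset, glex m l → glex m l' → glex m (lexInf l l')) ∧
    glex 0 (1 : ↥Qset → ℝ) ∧
    (∀ l ∈ Gset, ∃ m : ℕ, 0 < m ∧ glex l (m • (1 : ↥Qset → ℝ))) ∧
    -- σ(l) = l ∘ q is a surjective unital ℓ-endomorphism of (G,1) with nonzero kernel:
    (Set.MapsTo (fun l : ↥Qset → ℝ => l ∘ qmapQ) Gset Gset ∧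
     (∀ l ∈ Gset, ∀ l' ∈ Gset, (l + l') ∘ qmapQ = l ∘ qmapQ + l' ∘ qmapQ) ∧
     (∀ l ∈ Gset, ∀ l' ∈ Gset, lexSup l l' ∘ qmapQ = lexSup (l ∘ qmapQ) (l' ∘ qmapQ)) ∧
     (∀ l ∈ Gset, ∀ l' ∈ Gset, lexInf l l' ∘ qmapQ = lexInf (l ∘ qmapQ) (l' ∘ qmapQ)) ∧
     ((1 : ↥Qset → ℝ) ∘ qmapQ = 1) ∧
     Set.SurjOn (fun l : ↥Qset → ℝ => l ∘ qmapQ) Gset Gset ∧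
     ((fun v : ↥Qset => max (v.1.1 - v.1.2) 0) ∈ Gset) ∧
     (fun v : ↥Qset => max (v.1.1 - v.1.2) 0) ≠ (0 : ↥Qset → ℝ) ∧
     (fun v : ↥Qset => max (v.1.1 - v.1.2) 0) ∘ qmapQ = (0 : ↥Qset → ℝ) ∧
     ¬ Set.InjOn (fun l : ↥Qset → ℝ => l ∘ qmapQ) Gset) := by
  have zero_mem : (0 : ↥Qset → ℝ) ∈ Gset := const_mem_Gset 0 (by simp)
  refine ⟨const_mem_Gset 1 (by simp), zero_mem, fun l hl l' hl' => add_mem_Gset hl hl',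
    fun l hl => neg_mem_Gset hl, fun l _ => glex_refl l,
    fun l _ l' _ => glex_antisymm, fun l _ l' _ l'' _ => glex_trans,
    fun l _ l' _ k _ h => glex_add_right h k,
    fun l hl l' hl' => ⟨lexSup_mem_Gset hl hl', glex_lexSup_left l l', glex_lexSup_right l l',
      fun m _ => lexSup_glex⟩,
    fun l hl l' hl' => ?_, Or.inl (by simp), fun l _ => ?_,
    fun l hl => comp_qmapQ_mem_Gset hl, fun _ _ _ _ => rfl,
    fun l _ l' _ => lexSup_comp_qmapQ l l', fun l _ l' _ => lexInf_comp_qmapQ l l', rfl,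
    fun l hl => exists_comp_qmapQ_eq hl, max_sub_zero_mem_Gset, max_sub_zero_ne_zero,
    max_sub_zero_comp_qmapQ,
    fun hinj => max_sub_zero_ne_zero (hinj max_sub_zero_mem_Gset zero_mem
      max_sub_zero_comp_qmapQ)⟩
  · rw [lexInf_eq_neg_lexSup]
    refine ⟨neg_mem_Gset (lexSup_mem_Gset (neg_mem_Gset hl') (neg_mem_Gset hl)), ?_, ?_,
      fun m _ h h' => ?_⟩
    · rw [← glex_neg_neg, neg_neg]
      exact glex_lexSup_right _ _
    · rw [← glex_neg_neg, neg_neg]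
      exact glex_lexSup_left _ _
    · rw [← glex_neg_neg, neg_neg]
      exact lexSup_glex (glex_neg_neg.2 h') (glex_neg_neg.2 h)
  · obtain ⟨n, hn⟩ := exists_nat_gt (l originQ)
    refine ⟨n + 1, n.succ_pos, Or.inl ?_⟩
    simp only [Pi.smul_apply, Pi.one_apply, nsmul_eq_mul, mul_one, Nat.cast_add, Nat.cast_one]
    linarith
end

section
/- Let n ≥ 1 and let g_1, …, g_n ∈ McN([0,1]^n) be a generating set of McN([0,1]^n), i.e., the smallest subset of McN([0,1]^n) containing g_1, …, g_n and the constant function 0 and closed under ¬ and ⊕ is all of McN([0,1]^n). Let g : [0,1]^n → [0,1]^n be the map g(x) = (g_1(x), …, g_n(x)). Then the MV-endomorphism η : f ↦ f ∘ g of McN([0,1]^n) is bijective; in other words, every n-element generating set of the free n-generator MV-algebra McN([0,1]^n) is a free generating set. -/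
open Set BigOperators

/-- The unit cube `[0,1]^n` as a subset of `Fin n → ℝ`. -/
def cube (n : ℕ) : Set (Fin n → ℝ) := Set.Icc 0 1

/-- An (affine) linear polynomial with integer coefficients. -/
def IsAffineZ {n : ℕ} (p : (Fin n → ℝ) → ℝ) : Prop :=
  ∃ (m : ℤ) (c : Fin n → ℤ), ∀ x, p x = (m : ℝ) + ∑ i, (c i : ℝ) * x i

/-- A McNaughton function on `[0,1]^n`: continuous, `[0,1]`-valued, and agreeing at each
point of the cube with one of finitely many affine polynomials with integer coefficients. -/
def IsMcNaughton {n : ℕ} (f : (Fin n → ℝ) → ℝ) : Prop :=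
  ContinuousOn f (cube n) ∧ (∀ x ∈ cube n, f x ∈ Set.Icc (0:ℝ) 1) ∧
  ∃ (u : ℕ) (p : Fin u → (Fin n → ℝ) → ℝ),
    (∀ j, IsAffineZ (p j)) ∧ ∀ x ∈ cube n, ∃ j, f x = p j x

/-- `McN X`: restrictions to `X` of McNaughton functions on `[0,1]^n`. -/
def McN {n : ℕ} (X : Set (Fin n → ℝ)) : Set (↥X → ℝ) :=
  {g : ↥X → ℝ | ∃ f, IsMcNaughton (n := n) f ∧ ∀ x : X, g x = f x.1}

/-- Pointwise MV-negation `¬f = 1 - f`. -/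
def mvNeg {α : Type*} (f : α → ℝ) : α → ℝ := fun x => 1 - f x

/-- Pointwise MV-sum `f ⊕ g = min(1, f + g)`. -/
def mvOplus {α : Type*} (f g : α → ℝ) : α → ℝ := fun x => min 1 (f x + g x)

/-- A point all of whose coordinates are rational. -/
def IsRationalPoint {n : ℕ} (x : Fin n → ℝ) : Prop := ∀ i, ∃ q : ℚ, x i = (q : ℝ)

/-- An MV-endomorphism of `McN X`. -/
def IsMVEndo {n : ℕ} (X : Set (Fin n → ℝ)) (σ : (↥X → ℝ) → (↥X → ℝ)) : Prop :=
  Set.MapsTo σ (McN X) (McN X) ∧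
  σ (fun _ => 0) = (fun _ => 0) ∧
  (∀ f ∈ McN X, σ (mvNeg f) = mvNeg (σ f)) ∧
  (∀ f ∈ McN X, ∀ g ∈ McN X, σ (mvOplus f g) = mvOplus (σ f) (σ g))

open MeasureTheory

section McNaughton

variable {n : ℕ}

theorem IsMcNaughton.of_fintype {ι : Type*} [Fintype ι] {f : (Fin n → ℝ) → ℝ}
    (hc : ContinuousOn f (cube n)) (hr : ∀ x ∈ cube n, f x ∈ Set.Icc (0:ℝ) 1)
    (p : ι → (Fin n → ℝ) → ℝ) (hp : ∀ j, IsAffineZ (p j))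
    (hf : ∀ x ∈ cube n, ∃ j, f x = p j x) : IsMcNaughton f := by
  refine ⟨hc, hr, Fintype.card ι, fun k => p ((Fintype.equivFin ι).symm k), fun k => hp _, ?_⟩
  intro x hx
  obtain ⟨j, hj⟩ := hf x hx
  exact ⟨Fintype.equivFin ι j, by simpa using hj⟩

theorem IsAffineZ.const (m : ℤ) : IsAffineZ (fun _ : Fin n → ℝ => (m : ℝ)) :=
  ⟨m, 0, fun x => by simp⟩

theorem IsAffineZ.proj (i : Fin n) : IsAffineZ (fun x : Fin n → ℝ => x i) :=
  ⟨0, Pi.single i 1, fun x => by simp [Pi.single_apply]⟩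

theorem IsAffineZ.add {p q : (Fin n → ℝ) → ℝ} (hp : IsAffineZ p) (hq : IsAffineZ q) :
    IsAffineZ (fun x => p x + q x) := by
  obtain ⟨m, c, h⟩ := hp
  obtain ⟨m', c', h'⟩ := hq
  refine ⟨m + m', c + c', fun x => ?_⟩
  simp only [h, h', Pi.add_apply, Int.cast_add, add_mul, Finset.sum_add_distrib]
  ring

theorem IsAffineZ.const_mul {p : (Fin n → ℝ) → ℝ} (a : ℤ) (hp : IsAffineZ p) :
    IsAffineZ (fun x => (a : ℝ) * p x) := by
  obtain ⟨m, c, h⟩ := hp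
  refine ⟨a * m, fun i => a * c i, fun x => ?_⟩
  simp only [h, mul_add, Finset.mul_sum, Int.cast_mul, mul_assoc]

theorem IsAffineZ.sum {ι : Type*} (s : Finset ι) {p : ι → (Fin n → ℝ) → ℝ}
    (hp : ∀ i, IsAffineZ (p i)) : IsAffineZ (fun x => ∑ i ∈ s, p i x) := by
  classical
  induction s using Finset.induction_on with
  | empty => simpa using IsAffineZ.const (n := n) 0
  | insert a s ha ih => simpa [Finset.sum_insert ha] using (hp a).add ih

theorem IsAffineZ.comp {k : ℕ} {p : (Fin k → ℝ) → ℝ} {q : Fin k → (Fin n → ℝ) → ℝ}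
    (hp : IsAffineZ p) (hq : ∀ i, IsAffineZ (q i)) : IsAffineZ (fun x => p (fun i => q i x)) := by
  obtain ⟨m, c, h⟩ := hp
  simp only [h]
  exact (IsAffineZ.const m).add (IsAffineZ.sum _ fun i => (hq i).const_mul (c i))

theorem IsMcNaughton.comp {k : ℕ} {f : (Fin k → ℝ) → ℝ} {g : Fin k → (Fin n → ℝ) → ℝ}
    (hf : IsMcNaughton f) (hg : ∀ i, IsMcNaughton (g i)) :
    IsMcNaughton (fun x => f (fun i => g i x)) := by
  have hmaps : MapsTo (fun x i => g i x) (cube n) (cube k) := fun x hx =>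
    ⟨fun i => ((hg i).2.1 x hx).1, fun i => ((hg i).2.1 x hx).2⟩
  obtain ⟨hfc, hfr, u, p, hp, hfp⟩ := hf
  choose hgc hgr v q hq hgq using hg
  refine IsMcNaughton.of_fintype (ι := Fin u × (∀ i, Fin (v i)))
    (hfc.comp (continuousOn_pi.2 hgc) hmaps) (fun x hx => hfr _ (hmaps hx))
    (fun j x => p j.1 (fun i => q i (j.2 i) x)) (fun j => (hp _).comp fun i => hq _ _) ?_
  intro x hx
  obtain ⟨j, hj⟩ := hfp _ (hmaps hx)
  choose l hl using fun i => hgq i x hx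
  refine ⟨(j, l), ?_⟩
  simp only [← hl]
  exact hj

theorem IsMcNaughton.proj (i : Fin n) : IsMcNaughton (fun x : Fin n → ℝ => x i) :=
  IsMcNaughton.of_fintype (ι := Unit) (by fun_prop) (fun x hx => ⟨hx.1 i, hx.2 i⟩)
    (fun _ x => x i) (fun _ => IsAffineZ.proj i) fun _ _ => ⟨(), rfl⟩

theorem IsMcNaughton.zero : IsMcNaughton (fun _ : Fin n → ℝ => (0 : ℝ)) :=
  IsMcNaughton.of_fintype (ι := Unit) (by fun_prop) (fun x hx => by simp)
    (fun _ _ => 0) (fun _ => by simpa using IsAffineZ.const (n := n) 0) fun _ _ => ⟨(), rfl⟩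

theorem IsMcNaughton.neg {f : (Fin n → ℝ) → ℝ} (hf : IsMcNaughton f) : IsMcNaughton (mvNeg f) := by
  obtain ⟨hc, hr, u, p, hp, hfp⟩ := hf
  refine ⟨continuousOn_const.sub hc, fun x hx => ?_, u,
    fun j x => ((1 : ℤ) : ℝ) + ((-1 : ℤ) : ℝ) * p j x,
    fun j => (IsAffineZ.const 1).add ((hp j).const_mul (-1)), fun x hx => ?_⟩
  · have := hr x hx
    simp only [mvNeg, mem_Icc] at this ⊢
    constructor <;> linarith
  · obtain ⟨j, hj⟩ := hfp x hx
    refine ⟨j, ?_⟩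
    rw [mvNeg, hj]
    push_cast
    ring

theorem IsMcNaughton.oplus {f g : (Fin n → ℝ) → ℝ} (hf : IsMcNaughton f) (hg : IsMcNaughton g) :
    IsMcNaughton (mvOplus f g) := by
  obtain ⟨hc, hr, u, p, hp, hfp⟩ := hf
  obtain ⟨hc', hr', u', p', hp', hfp'⟩ := hg
  refine IsMcNaughton.of_fintype (ι := Option (Fin u × Fin u'))
    (ContinuousOn.inf continuousOn_const (hc.add hc')) (fun x hx => ?_)
    (fun j x => j.elim ((1 : ℤ) : ℝ) fun k => p k.1 x + p' k.2 x) ?_ fun x hx => ?_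
  · exact ⟨le_min zero_le_one (add_nonneg (hr x hx).1 (hr' x hx).1), min_le_left _ _⟩
  · rintro (_ | k)
    · exact IsAffineZ.const 1
    · exact (hp k.1).add (hp' k.2)
  · obtain ⟨j, hj⟩ := hfp x hx
    obtain ⟨k, hk⟩ := hfp' x hx
    rcases min_choice 1 (f x + g x) with h | h
    · exact ⟨none, by simpa [mvOplus] using h⟩
    · exact ⟨some (j, k), by simpa [mvOplus, ← hj, ← hk] using h⟩

theorem zero_mem_McN (X : Set (Fin n → ℝ)) : (fun _ => (0 : ℝ)) ∈ McN X :=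
  ⟨_, IsMcNaughton.zero, fun _ => rfl⟩

theorem mvNeg_mem_McN {X : Set (Fin n → ℝ)} {f : ↥X → ℝ} (hf : f ∈ McN X) : mvNeg f ∈ McN X := by
  obtain ⟨F, hF, h⟩ := hf
  exact ⟨_, hF.neg, fun x => by simp only [mvNeg, h]⟩

theorem mvOplus_mem_McN {X : Set (Fin n → ℝ)} {f g : ↥X → ℝ} (hf : f ∈ McN X) (hg : g ∈ McN X) :
    mvOplus f g ∈ McN X := by
  obtain ⟨F, hF, h⟩ := hf
  obtain ⟨G, hG, h'⟩ := hg
  exact ⟨_, hF.oplus hG, fun x => by simp only [mvOplus, h, h']⟩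

/-- The affine self-map of `ℝⁿ` with integer matrix `A` and integer translation part `a`. -/
def affineMapZ (a : Fin n → ℤ) (A : Matrix (Fin n) (Fin n) ℤ) (x : Fin n → ℝ) : Fin n → ℝ :=
  (fun i => (a i : ℝ)) + Matrix.toLin' (A.map (Int.cast : ℤ → ℝ)) x

theorem affineMapZ_apply (a : Fin n → ℤ) (A : Matrix (Fin n) (Fin n) ℤ) (x : Fin n → ℝ)
    (i : Fin n) :
    affineMapZ a A x i = (a i : ℝ) + ∑ j, (A i j : ℝ) * x j := by
  simp [affineMapZ, Matrix.mulVec, dotProduct]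

theorem continuous_affineMapZ (a : Fin n → ℤ) (A : Matrix (Fin n) (Fin n) ℤ) :
    Continuous (affineMapZ a A) :=
  continuous_const.add (LinearMap.continuous_of_finiteDimensional _)

/-- A linear map that is constant on a set of positive Lebesgue measure is zero. -/
theorem LinearMap.eq_zero_of_eqOn_const {L : (Fin n → ℝ) →ₗ[ℝ] (Fin n → ℝ)} {c : Fin n → ℝ}
    {E : Set (Fin n → ℝ)} (hE : volume E ≠ 0) (h : ∀ x ∈ E, L x = c) : L = 0 := by
  by_contra hL
  obtain ⟨e, he⟩ := nonempty_of_measure_ne_zero hE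
  have hker : volume (LinearMap.ker L : Set (Fin n → ℝ)) = 0 :=
    Measure.addHaar_submodule _ _ fun h => hL (LinearMap.ker_eq_top.1 h)
  have hsub : E ⊆ (fun x => -e + x) ⁻¹' (LinearMap.ker L : Set (Fin n → ℝ)) := by
    intro x hx
    simp [h x hx, h e he]
  exact hE (measure_mono_null hsub (by rw [measure_preimage_add]; exact hker))

/-- An integral affine map with an integral affine left inverse on `E` does not decrease the
Lebesgue measure of `E`. -/
theorem volume_le_volume_image_affineMapZ (a b : Fin n → ℤ) (A B : Matrix (Fin n) (Fin n) ℤ)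
    {E : Set (Fin n → ℝ)} (h : ∀ x ∈ E, affineMapZ b B (affineMapZ a A x) = x) :
    volume E ≤ volume (affineMapZ a A '' E) := by
  by_cases hE : volume E = 0
  · simp [hE]
  set A' : Matrix (Fin n) (Fin n) ℝ := A.map (Int.cast : ℤ → ℝ)
  set B' : Matrix (Fin n) (Fin n) ℝ := B.map (Int.cast : ℤ → ℝ)
  have hL : LinearMap.id - Matrix.toLin' B' ∘ₗ Matrix.toLin' A' = 0 := by
    refine LinearMap.eq_zero_of_eqOn_const hE
      (c := (fun i => (b i : ℝ)) + Matrix.toLin' B' (fun i => (a i : ℝ))) fun x hx => ?_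
    have := h x hx
    simp only [affineMapZ, map_add] at this
    rw [LinearMap.sub_apply, sub_eq_iff_eq_add, LinearMap.id_apply, LinearMap.comp_apply, add_assoc]
    exact this.symm
  have hdet : LinearMap.det (Matrix.toLin' A') ≠ 0 := by
    have : LinearMap.det (Matrix.toLin' B') * LinearMap.det (Matrix.toLin' A') = 1 := by
      rw [← LinearMap.det_comp, ← sub_eq_zero.1 hL, LinearMap.det_id]
    exact right_ne_zero_of_mul_eq_one this
  have hcast : LinearMap.det (Matrix.toLin' A') = ((A.det : ℤ) : ℝ) := by
    rw [LinearMap.det_toLin']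
    exact (Int.cast_det A).symm
  have hone : 1 ≤ |LinearMap.det (Matrix.toLin' A')| := by
    rw [hcast] at hdet ⊢
    exact_mod_cast Int.one_le_abs (by exact_mod_cast hdet)
  have himage : affineMapZ a A '' E
      = (fun y => (fun i => (a i : ℝ)) + y) '' (Matrix.toLin' A' '' E) := by
    rw [image_image]
    rfl
  rw [himage, image_add_left, measure_preimage_add, Measure.addHaar_image_linearMap]
  calc volume E = 1 * volume E := (one_mul _).symm
    _ ≤ _ := by
      gcongr
      simpa using ENNReal.ofReal_le_ofReal hone

/-- If a continuous injective map does not decrease the measure of subsets of each of finitely many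
measurable pieces, it does not decrease the measure of a measurable set covered by the pieces. -/
theorem volume_le_volume_image_of_cover {ι : Type*} (s : Finset ι) (C : ι → Set (Fin n → ℝ))
    (hC : ∀ i, MeasurableSet (C i)) (g : (Fin n → ℝ) → (Fin n → ℝ))
    (hvol : ∀ i, ∀ E ⊆ C i, volume E ≤ volume (g '' E)) (E : Set (Fin n → ℝ))
    (hE : MeasurableSet E) (hg : ContinuousOn g E) (hinj : InjOn g E)
    (hcover : E ⊆ ⋃ i ∈ s, C i) : volume E ≤ volume (g '' E) := by
  classical
  induction s using Finset.induction_on generalizing E with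
  | empty =>
    have : E = ∅ := by simpa using hcover
    simp [this]
  | insert a s ha ih =>
    have hdiff : volume (E \ C a) ≤ volume (g '' (E \ C a)) := by
      refine ih _ (hE.diff (hC a)) (hg.mono sdiff_subset) (hinj.mono sdiff_subset) fun x hx => ?_
      have := hcover hx.1
      rw [Finset.set_biUnion_insert] at this
      exact this.resolve_left hx.2
    have hdisj : Disjoint (g '' (E ∩ C a)) (g '' (E \ C a)) :=
      disjoint_image_image fun x hx y hy hxy => hy.2 (hinj hx.1 hy.1 hxy ▸ hx.2)
    calc volume E = volume (E ∩ C a) + volume (E \ C a) := (measure_inter_add_sdiff E (hC a)).symm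
      _ ≤ volume (g '' (E ∩ C a)) + volume (g '' (E \ C a)) :=
        add_le_add (hvol a _ inter_subset_right) hdiff
      _ = volume (g '' (E ∩ C a) ∪ g '' (E \ C a)) :=
        (measure_union hdisj ((hE.diff (hC a)).image_of_continuousOn_injOn
          (hg.mono sdiff_subset) (hinj.mono sdiff_subset))).symm
      _ = volume (g '' E) := by rw [← image_union, inter_union_sdiff]

theorem isCompact_cube : IsCompact (cube n) := isCompact_Icc

theorem cube_subset_closure_interior : cube n ⊆ closure (interior (cube n)) := by
  have h : cube n = pi univ fun _ => Icc (0 : ℝ) 1 := (pi_univ_Icc 0 1).symm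
  rw [h, interior_pi_set finite_univ, closure_pi_set]
  simp [closure_Ioo (zero_ne_one' ℝ)]

/-- A closed subset of the cube of at least the same volume is the whole cube. -/
theorem eq_cube_of_volume_le {K : Set (Fin n → ℝ)} (hK : IsClosed K) (hsub : K ⊆ cube n)
    (hvol : volume (cube n) ≤ volume K) : K = cube n := by
  refine hsub.antisymm fun y hy => ?_
  by_contra hyK
  obtain ⟨z, hzK, hz⟩ := mem_closure_iff.1 (cube_subset_closure_interior hy) _ hK.isOpen_compl hyK
  have hfin : volume (cube n) ≠ ⊤ := isCompact_cube.measure_ne_top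
  have hnull : volume (cube n \ K) = 0 := by
    rw [measure_sdiff hsub hK.measurableSet.nullMeasurableSet (measure_ne_top_of_subset hsub hfin)]
    exact tsub_eq_zero_of_le hvol
  refine (hK.isOpen_compl.inter isOpen_interior).measure_ne_zero volume ⟨z, hzK, hz⟩
    (measure_mono_null (t := cube n \ K) (fun x hx => ⟨interior_subset hx.2, hx.1⟩) hnull)

/-- A tuple of McNaughton functions having a McNaughton left inverse maps the cube onto itself. -/
theorem surjOn_cube_of_leftInvOn {G H : Fin n → (Fin n → ℝ) → ℝ} (hG : ∀ i, IsMcNaughton (G i))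
    (hH : ∀ i, IsMcNaughton (H i))
    (hHG : LeftInvOn (fun y i => H i y) (fun x i => G i x) (cube n)) :
    SurjOn (fun x i => G i x) (cube n) (cube n) := by
  set g : (Fin n → ℝ) → (Fin n → ℝ) := fun x i => G i x
  have hmaps : MapsTo g (cube n) (cube n) := fun x hx =>
    ⟨fun i => ((hG i).2.1 x hx).1, fun i => ((hG i).2.1 x hx).2⟩
  have hcont : ContinuousOn g (cube n) := continuousOn_pi.2 fun i => (hG i).1
  choose u p hp hGp using fun i => (hG i).2.2
  choose v q hq hHq using fun i => (hH i).2.2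
  choose a A hA using hp
  choose b B hB using hq
  let P : (∀ i, Fin (u i)) → (Fin n → ℝ) → (Fin n → ℝ) := fun j =>
    affineMapZ (fun i => a i (j i)) (Matrix.of fun i => A i (j i))
  let Q : (∀ i, Fin (v i)) → (Fin n → ℝ) → (Fin n → ℝ) := fun k =>
    affineMapZ (fun i => b i (k i)) (Matrix.of fun i => B i (k i))
  have hP : ∀ j, Continuous (P j) := fun j => continuous_affineMapZ _ _
  have hQ : ∀ k, Continuous (Q k) := fun k => continuous_affineMapZ _ _
  let C : (∀ i, Fin (u i)) × (∀ i, Fin (v i)) → Set (Fin n → ℝ) := fun jk =>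
    (cube n ∩ (fun x => g x - P jk.1 x) ⁻¹' {0}) ∩ {x | Q jk.2 (P jk.1 x) = x}
  have hCmeas : ∀ jk, MeasurableSet (C jk) := fun jk =>
    (((hcont.sub (hP jk.1).continuousOn).preimage_isClosed_of_isClosed isCompact_cube.isClosed
      isClosed_singleton).inter
        (isClosed_eq ((hQ jk.2).comp (hP jk.1)) continuous_id)).measurableSet
  have hCvol : ∀ jk, ∀ E ⊆ C jk, volume E ≤ volume (g '' E) := by
    intro jk E hE
    have himage : g '' E = P jk.1 '' E := image_congr fun x hx => sub_eq_zero.1 (hE hx).1.2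
    rw [himage]
    exact volume_le_volume_image_affineMapZ _ _ _ _ fun x hx => (hE hx).2
  have hcover : cube n ⊆ ⋃ jk ∈ Finset.univ, C jk := by
    intro x hx
    choose j hj using fun i => hGp i x hx
    choose k hk using fun i => hHq i (g x) (hmaps hx)
    have hPx : g x = P j x := by
      ext i
      exact ((hj i).trans (hA i (j i) x)).trans
        (affineMapZ_apply (fun i => a i (j i)) (Matrix.of fun i => A i (j i)) x i).symm
    have hQx : Q k (g x) = x := by
      ext i
      exact (affineMapZ_apply _ _ _ _).trans
        (((hk i).trans (hB i (k i) (g x))).symm.trans (congrFun (hHG hx) i))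
    refine mem_biUnion (Finset.mem_coe.2 (Finset.mem_univ (j, k))) ⟨⟨hx, sub_eq_zero.2 hPx⟩, ?_⟩
    show Q k (P j x) = x
    rw [← hPx, hQx]
  have hvol := volume_le_volume_image_of_cover Finset.univ C hCmeas g hCvol (cube n)
    isCompact_cube.measurableSet hcont hHG.injOn hcover
  exact (eq_cube_of_volume_le (isCompact_cube.image_of_continuousOn hcont).isClosed
    hmaps.image_subset hvol).ge

end McNaughton

/-- every `n`-element generating set `g_1, …, g_n` of the free
`n`-generator MV-algebra `McN([0,1]^n)` is a free generating set: the induced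
MV-endomorphism `η : f ↦ f ∘ g`, where `g(x) = (g_1(x), …, g_n(x))`, is a bijection of
`McN([0,1]^n)` onto itself. -/
theorem stmt16 {n : ℕ} (hn : 1 ≤ n) (gs : Fin n → (↥(cube n) → ℝ))
    (hgs : ∀ i, gs i ∈ McN (cube n))
    (hg : ∀ x : ↥(cube n), (fun i => gs i x) ∈ cube n)
    (hgen : ∀ S : Set (↥(cube n) → ℝ), S ⊆ McN (cube n) →
      (∀ i, gs i ∈ S) → (fun _ => (0:ℝ)) ∈ S →
      (∀ f ∈ S, mvNeg f ∈ S) → (∀ f ∈ S, ∀ g ∈ S, mvOplus f g ∈ S) →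
      McN (cube n) ⊆ S) :
    Set.BijOn (fun f : ↥(cube n) → ℝ => fun x : ↥(cube n) => f ⟨fun i => gs i x, hg x⟩)
      (McN (cube n)) (McN (cube n)) := by
  choose G hG hGgs using hgs
  have hgsG : ∀ x : ↥(cube n), (fun i => gs i x) = fun i => G i x.1 := fun x =>
    funext fun i => hGgs i x
  set η : (↥(cube n) → ℝ) → (↥(cube n) → ℝ) := fun f x => f ⟨fun i => gs i x, hg x⟩ with hη
  have hmaps : MapsTo η (McN (cube n)) (McN (cube n)) := by
    rintro f ⟨F, hF, hfF⟩
    refine ⟨_, hF.comp hG, fun x => ?_⟩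
    rw [← hgsG x]
    exact hfF _
  have hsurj : SurjOn η (McN (cube n)) (McN (cube n)) := by
    refine hgen (η '' McN (cube n)) hmaps.image_subset ?_ ?_ ?_ ?_
    · exact fun i => ⟨fun x => x.1 i, ⟨_, IsMcNaughton.proj i, fun _ => rfl⟩, rfl⟩
    · exact ⟨_, zero_mem_McN _, rfl⟩
    · rintro _ ⟨f, hf, rfl⟩
      exact ⟨_, mvNeg_mem_McN hf, rfl⟩
    · rintro _ ⟨f, hf, rfl⟩ _ ⟨f', hf', rfl⟩
      exact ⟨_, mvOplus_mem_McN hf hf', rfl⟩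
  refine ⟨hmaps, ?_, hsurj⟩
  have hproj : ∀ i, ∃ H, IsMcNaughton H ∧ ∀ x : ↥(cube n), H (fun j => G j x.1) = x.1 i := by
    intro i
    obtain ⟨f, ⟨H, hH, hfH⟩, hf⟩ :=
      hsurj (show (fun x : ↥(cube n) => x.1 i) ∈ McN (cube n) from
        ⟨_, IsMcNaughton.proj i, fun _ => rfl⟩)
    refine ⟨H, hH, fun x => ?_⟩
    rw [← hgsG x]
    exact (hfH ⟨_, hg x⟩).symm.trans (congrFun hf x)
  choose H hH hHG using hproj
  have hG_surj := surjOn_cube_of_leftInvOn hG hH fun x hx => funext fun i => hHG i ⟨x, hx⟩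
  intro f _ f' _ hff'
  ext ⟨y, hy⟩
  obtain ⟨x, hx, rfl⟩ := hG_surj hy
  have h := congrFun hff' ⟨x, hx⟩
  simp only [hη, hgsG] at h
  exact h
end

section
/- Let n ≥ 1 and let g_1, …, g_n ∈ A_n be a generating set of A_n, i.e., the smallest subgroup of A_n containing g_1, …, g_n and closed under ∨ and ∧ is all of A_n. Let g : ℝ^n → ℝ^n be the map g(x) = (g_1(x), …, g_n(x)). Then the ℓ-endomorphism f ↦ f ∘ g of A_n is bijective; in other words, every n-element generating set of the free n-generator ℓ-group A_n is a free generating set. -/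
open Set BigOperators

/-- A homogeneous linear polynomial on `ℝ^n` with integer coefficients. -/
def IsHomLinZ {n : ℕ} (p : (Fin n → ℝ) → ℝ) : Prop :=
  ∃ c : Fin n → ℤ, ∀ x, p x = ∑ i, (c i : ℝ) * x i

/-- The free `n`-generator ℓ-group `A_n`: continuous piecewise homogeneous linear
functions on `ℝ^n` with integer coefficients. -/
def Afree (n : ℕ) : Set ((Fin n → ℝ) → ℝ) :=
  {f : (Fin n → ℝ) → ℝ | Continuous f ∧ ∃ (u : ℕ) (p : Fin u → (Fin n → ℝ) → ℝ),
    (∀ j, IsHomLinZ (p j)) ∧ ∀ x, ∃ j, f x = p j x}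

theorem afree_iff {n : ℕ} {f : (Fin n → ℝ) → ℝ} :
    f ∈ Afree n ↔ Continuous f ∧ ∃ F : Set (Fin n → ℤ), F.Finite ∧
      ∀ x, ∃ c ∈ F, f x = ∑ i, (c i : ℝ) * x i := by
  constructor
  · rintro ⟨hf, u, p, hp, hx⟩
    choose c hc using hp
    refine ⟨hf, Set.range c, Set.finite_range c, fun x => ?_⟩
    obtain ⟨j, hj⟩ := hx x
    exact ⟨c j, ⟨j, rfl⟩, hj.trans (hc j x)⟩
  · rintro ⟨hf, F, hF, hx⟩
    obtain ⟨u, c, -, hc⟩ := hF.fin_param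
    refine ⟨hf, u, fun j x => ∑ i, (c j i : ℝ) * x i, fun j => ⟨c j, fun x => rfl⟩, fun x => ?_⟩
    obtain ⟨d, hd, hdx⟩ := hx x
    rw [← hc] at hd
    obtain ⟨j, rfl⟩ := hd
    exact ⟨j, hdx⟩

namespace Afree

variable {n : ℕ} {f g : (Fin n → ℝ) → ℝ}

theorem zero_mem : (0 : (Fin n → ℝ) → ℝ) ∈ Afree n :=
  afree_iff.2 ⟨continuous_zero, {0}, Set.finite_singleton 0, fun x => ⟨0, rfl, by simp⟩⟩

theorem coord_mem (i : Fin n) : (fun x : Fin n → ℝ => x i) ∈ Afree n :=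
  afree_iff.2 ⟨continuous_apply i, {Pi.single i 1}, Set.finite_singleton _,
    fun x => ⟨_, rfl, by simp [Pi.single_apply]⟩⟩

theorem add_mem (hf : f ∈ Afree n) (hg : g ∈ Afree n) : f + g ∈ Afree n := by
  obtain ⟨hfc, F, hF, hfF⟩ := afree_iff.1 hf
  obtain ⟨hgc, G, hG, hgG⟩ := afree_iff.1 hg
  refine afree_iff.2 ⟨hfc.add hgc, _, hF.image2 (· + ·) hG, fun x => ?_⟩
  obtain ⟨c, hc, hcx⟩ := hfF x
  obtain ⟨d, hd, hdx⟩ := hgG x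
  exact ⟨c + d, ⟨c, hc, d, hd, rfl⟩, by simp [hcx, hdx, add_mul, Finset.sum_add_distrib]⟩

theorem neg_mem (hf : f ∈ Afree n) : -f ∈ Afree n := by
  obtain ⟨hfc, F, hF, hfF⟩ := afree_iff.1 hf
  refine afree_iff.2 ⟨hfc.neg, _, hF.image Neg.neg, fun x => ?_⟩
  obtain ⟨c, hc, hcx⟩ := hfF x
  exact ⟨-c, ⟨c, hc, rfl⟩, by simp [hcx]⟩

theorem mem_of_eq_or_eq {k : (Fin n → ℝ) → ℝ} (hf : f ∈ Afree n) (hg : g ∈ Afree n)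
    (hk : Continuous k) (h : ∀ x, k x = f x ∨ k x = g x) : k ∈ Afree n := by
  obtain ⟨-, F, hF, hfF⟩ := afree_iff.1 hf
  obtain ⟨-, G, hG, hgG⟩ := afree_iff.1 hg
  refine afree_iff.2 ⟨hk, _, hF.union hG, fun x => ?_⟩
  obtain h | h := h x
  · obtain ⟨c, hc, hcx⟩ := hfF x
    exact ⟨c, .inl hc, h.trans hcx⟩
  · obtain ⟨c, hc, hcx⟩ := hgG x
    exact ⟨c, .inr hc, h.trans hcx⟩

theorem sup_mem (hf : f ∈ Afree n) (hg : g ∈ Afree n) : f ⊔ g ∈ Afree n :=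
  mem_of_eq_or_eq hf hg (hf.1.sup hg.1) fun x => by
    simpa [Pi.sup_apply] using le_total (g x) (f x)

theorem inf_mem (hf : f ∈ Afree n) (hg : g ∈ Afree n) : f ⊓ g ∈ Afree n :=
  mem_of_eq_or_eq hf hg (hf.1.inf hg.1) fun x => by
    simpa [Pi.inf_apply] using le_total (f x) (g x)

theorem exists_finite_matrix {gs : Fin n → (Fin n → ℝ) → ℝ} (hgs : ∀ i, gs i ∈ Afree n) :
    ∃ F : Set (Fin n → Fin n → ℤ), F.Finite ∧
      ∀ x, ∃ d ∈ F, ∀ i, gs i x = ∑ j, (d i j : ℝ) * x j := by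
  choose G hG hgG using fun i => (afree_iff.1 (hgs i)).2
  refine ⟨Set.pi Set.univ G, Set.Finite.pi' hG |>.subset fun d hd i => hd i trivial,
    fun x => ?_⟩
  choose d hd hdx using fun i => hgG i x
  exact ⟨d, fun i _ => hd i, hdx⟩

theorem comp_mem {gs : Fin n → (Fin n → ℝ) → ℝ} (hf : f ∈ Afree n)
    (hgs : ∀ i, gs i ∈ Afree n) : (fun x => f fun i => gs i x) ∈ Afree n := by
  obtain ⟨hfc, F, hF, hfF⟩ := afree_iff.1 hf
  obtain ⟨G, hG, hgG⟩ := exists_finite_matrix hgs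
  refine afree_iff.2 ⟨hfc.comp (continuous_pi fun i => (hgs i).1), _,
    hF.image2 (fun c d j => ∑ i, c i * d i j) hG, fun x => ?_⟩
  obtain ⟨c, hc, hcx⟩ := hfF fun i => gs i x
  obtain ⟨d, hd, hdx⟩ := hgG x
  refine ⟨_, ⟨c, hc, d, hd, rfl⟩, ?_⟩
  refine hcx.trans ?_
  simp only [hdx, Finset.mul_sum, Int.cast_sum, Int.cast_mul, Finset.sum_mul]
  rw [Finset.sum_comm]
  simp only [mul_assoc]

end Afree

section PiecewiseLinear

open Topology

variable {E : Type*} [NormedAddCommGroup E] [NormedSpace ℝ E]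

theorem IsPreconnected.exists_eqOn_of_pairwise_ne {X Y ι : Type*} [TopologicalSpace X]
    [TopologicalSpace Y] [T2Space Y] {F : Set ι} (hF : F.Finite) {m : ι → X → Y}
    (hm : ∀ i ∈ F, Continuous (m i)) {g : X → Y} (hg : Continuous g) {C : Set X}
    (hC : IsPreconnected C) (hne : C.Nonempty) (hgF : ∀ x ∈ C, ∃ i ∈ F, g x = m i x)
    (hdisj : ∀ x ∈ C, ∀ i ∈ F, ∀ j ∈ F, m i x = m j x → i = j) :
    ∃ i ∈ F, Set.EqOn g (m i) C := by
  obtain ⟨x₀, hx₀⟩ := hne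
  obtain ⟨i, hi, hix⟩ := hgF x₀ hx₀
  refine ⟨i, hi, ?_⟩
  have hA : IsClosed {x | g x = m i x} := isClosed_eq hg (hm i hi)
  have hB : IsClosed (⋃ j ∈ F \ {i}, {x | g x = m j x}) :=
    (hF.subset Set.sdiff_subset).isClosed_biUnion fun j hj => isClosed_eq hg (hm j hj.1)
  have hcover : C ⊆ {x | g x = m i x} ∪ ⋃ j ∈ F \ {i}, {x | g x = m j x} := by
    intro x hx
    obtain ⟨j, hj, hjx⟩ := hgF x hx
    by_cases hji : j = i
    · exact .inl (hji ▸ hjx)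
    · exact .inr (Set.mem_biUnion (show j ∈ F \ {i} from ⟨hj, hji⟩) hjx)
  have key : ∀ x ∈ C, g x = m i x → x ∉ ⋃ j ∈ F \ {i}, {x | g x = m j x} := by
    intro x hx hxi hxj
    simp only [Set.mem_iUnion] at hxj
    obtain ⟨j, hj, hjx⟩ := hxj
    exact hj.2 (hdisj x hx j hj.1 i hi (hjx.symm.trans hxi))
  obtain h | h := isPreconnected_iff_subset_of_disjoint_closed.1 hC _ _ hA hB hcover
    (Set.eq_empty_iff_forall_notMem.2 fun x hx => key x hx.1 hx.2.1 hx.2.2)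
  · exact h
  · exact absurd (h hx₀) (key x₀ hx₀ hix)

theorem tendsto_add_smul_nhdsGT_zero (x v : E) :
    Filter.Tendsto (fun t : ℝ => x + t • v) (𝓝[>] 0) (𝓝 x) := by
  have : Continuous fun t : ℝ => x + t • v := by fun_prop
  simpa using (this.tendsto 0).mono_left nhdsWithin_le_nhds

theorem LinearMap.injective_of_injOn_isOpen {M : E →ₗ[ℝ] E} {U : Set E} (hU : IsOpen U)
    (hne : U.Nonempty) (h : Set.InjOn M U) : Function.Injective M := by
  obtain ⟨x, hx⟩ := hne
  refine (injective_iff_map_eq_zero M).2 fun k hk => ?_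
  obtain ⟨t, ht, ht0⟩ := (((tendsto_add_smul_nhdsGT_zero x k).eventually
    (hU.mem_nhds hx)).and self_mem_nhdsWithin).exists
  have := h ht hx (by simp [hk])
  simpa [(ne_of_gt ht0 : t ≠ 0)] using this

variable [FiniteDimensional ℝ E]

theorem LinearMap.range_mem_nhds_of_eqOn {g : E → E} (hinj : Function.Injective g) {x : E}
    {U : Set E} (hU : IsOpen U) (hx : x ∈ U) {M : E →ₗ[ℝ] E} (hM : Set.EqOn g M U) :
    Set.range g ∈ 𝓝 (g x) := by
  have hMi : Function.Injective M := M.injective_of_injOn_isOpen hU ⟨x, hx⟩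
    fun a ha b hb hab => hinj (by rw [hM ha, hM hb, hab])
  let e := LinearEquiv.ofInjectiveEndo M hMi
  have he : ∀ y, M (e.symm y) = y := fun y => e.apply_symm_apply y
  have hc : Filter.Tendsto e.symm (𝓝 (g x)) (𝓝 x) := by
    have := (LinearMap.continuous_of_finiteDimensional e.symm.toLinearMap).tendsto (g x)
    rw [hM hx] at this ⊢
    rwa [show e.symm.toLinearMap (M x) = x from e.symm_apply_apply x] at this
  filter_upwards [hc.eventually (hU.mem_nhds hx)] with y hy
  exact ⟨e.symm y, by rw [hM hy, he]⟩

/-- An injective map which is linear on each of the two sides of a hyperplane near a point of it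
is locally onto there. -/
theorem LinearMap.range_mem_nhds_of_eqOn_halfspaces {g : E → E} (hg : Continuous g)
    (hinj : Function.Injective g) {x : E} {U : Set E} (hU : IsOpen U) (hx : x ∈ U)
    {l : E →ₗ[ℝ] ℝ} (hl : l ≠ 0) (hlx : l x = 0) {M N : E →ₗ[ℝ] E}
    (hM : Set.EqOn g M (U ∩ {y | 0 < l y})) (hN : Set.EqOn g N (U ∩ {y | l y < 0})) :
    Set.range g ∈ 𝓝 (g x) := by
  have hlc : Continuous l := l.continuous_of_finiteDimensional
  obtain ⟨u, hu⟩ : ∃ u, l u = 1 := LinearMap.surjective hl 1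
  have hray : ∀ y ∈ U, ∀ v : E, ∀ᶠ t : ℝ in 𝓝[>] 0, y + t • v ∈ U :=
    fun y hy v => (tendsto_add_smul_nhdsGT_zero y v).eventually (hU.mem_nhds hy)
  have extend : ∀ (s : ℝ) (P : E →ₗ[ℝ] E), s ≠ 0 → Set.EqOn g P (U ∩ {y | 0 < s * l y}) →
      ∀ y ∈ U, 0 ≤ s * l y → g y = P y := by
    intro s P hs hP y hy hsy
    have hcl := hP.closure hg P.continuous_of_finiteDimensional
    refine hcl (mem_closure_of_tendsto (tendsto_add_smul_nhdsGT_zero y (s • u)) ?_)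
    filter_upwards [hray y hy (s • u), self_mem_nhdsWithin] with t htU ht0
    refine ⟨htU, ?_⟩
    have : 0 < t * (s * s) := mul_pos ht0 (mul_self_pos.2 hs)
    simp only [Set.mem_ofPred_eq, map_add, map_smul, hu, smul_eq_mul, mul_one]
    nlinarith
  have hM' : ∀ y ∈ U, 0 ≤ l y → g y = M y := fun y hy hly =>
    extend 1 M one_ne_zero (by simpa using hM) y hy (by simpa using hly)
  have hN' : ∀ y ∈ U, l y ≤ 0 → g y = N y := fun y hy hly =>
    extend (-1) N (by norm_num) (by simpa using hN) y hy (by simpa using hly)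
  have hker : ∀ k, l k = 0 → N k = M k := by
    intro k hk
    obtain ⟨t, ht, ht0⟩ := ((hray x hx k).and self_mem_nhdsWithin).exists
    have h0 : l (x + t • k) = 0 := by simp [hlx, hk]
    have h1 := (hM' _ ht h0.ge).symm.trans (hN' _ ht h0.le)
    have h2 := (hM' _ hx hlx.ge).symm.trans (hN' _ hx hlx.le)
    simp only [map_add, map_smul, h2, add_right_inj] at h1
    exact (smul_right_injective E (ne_of_gt ht0 : t ≠ 0) h1).symm
  have hMi : Function.Injective M := by
    refine M.injective_of_injOn_isOpen (hU.inter (isOpen_lt continuous_const hlc)) ?_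
      fun a ha b hb hab => hinj (by rw [hM ha, hM hb, hab])
    obtain ⟨t, ht, ht0⟩ := ((hray x hx u).and self_mem_nhdsWithin).exists
    exact ⟨_, ht, by simpa [hlx, hu] using ht0⟩
  let e := LinearEquiv.ofInjectiveEndo M hMi
  have he : ∀ y, M (e.symm y) = y := fun y => e.apply_symm_apply y
  set w := e.symm (N u - M u) with hw
  have hNM : ∀ y, N y = M (y + l y • w) := by
    intro y
    have := hker (y - l y • u) (by simp [hu])
    rw [map_add, map_smul, hw, he, smul_sub]
    simp only [map_sub, map_smul] at this
    rw [← sub_eq_zero] at this ⊢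
    rw [← this]
    abel
  have hpos : 0 < 1 + l w := by
    by_contra! hneg
    obtain ⟨t, ⟨ht1, ht2⟩, ht0⟩ := (((hray x hx (-u)).and (hray x hx (-(u + w)))).and
      self_mem_nhdsWithin).exists
    have ht0 : 0 < t := ht0
    have hl1 : l (x + t • -u) = -t := by simp [hlx, hu]
    have hl2 : l (x + t • -(u + w)) = -(t * (1 + l w)) := by
      simp [hlx, hu]; ring
    have hl3 : 0 ≤ l (x + t • -(u + w)) := by rw [hl2]; nlinarith
    have heq : g (x + t • -u) = g (x + t • -(u + w)) := by
      rw [hN' _ ht1 (by rw [hl1]; linarith), hM' _ ht2 hl3, hNM, hl1]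
      congr 1
      module
    have := hinj heq
    rw [← this, hl1] at hl3
    linarith
  have hgx : g x = M x := hM' x hx hlx.ge
  have hc : Filter.Tendsto e.symm (𝓝 (g x)) (𝓝 x) := by
    have := (LinearMap.continuous_of_finiteDimensional e.symm.toLinearMap).tendsto (g x)
    rw [hgx] at this ⊢
    rwa [show e.symm.toLinearMap (M x) = x from e.symm_apply_apply x] at this
  have hc' : Filter.Tendsto (fun z => z - (l z / (1 + l w)) • w) (𝓝 x) (𝓝 x) := by
    have : Continuous fun z => z - (l z / (1 + l w)) • w := by fun_prop
    simpa [hlx] using this.tendsto x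
  filter_upwards [hc.eventually (hU.mem_nhds hx),
    (hc'.comp hc).eventually (hU.mem_nhds hx)] with y hy hy'
  obtain h | h := le_or_gt 0 (l (e.symm y))
  · exact ⟨_, (hM' _ hy h).trans (he y)⟩
  · have hlz : l (e.symm y - (l (e.symm y) / (1 + l w)) • w) = l (e.symm y) / (1 + l w) := by
      simp only [map_sub, map_smul, smul_eq_mul]
      field_simp
      ring
    refine ⟨_, (hN' _ hy' ?_).trans ?_⟩
    · simp only [Function.comp_apply, hlz]
      exact (div_neg_of_neg_of_pos h hpos).le
    · simp only [Function.comp_apply]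
      rw [hNM, hlz, sub_add_cancel, he]

/-- A nonempty open set is not covered by finitely many proper subspaces. -/
theorem Submodule.exists_mem_isOpen_forall_notMem {ι : Type*} {s : Set ι} (hs : s.Finite)
    {W : ι → Submodule ℝ E} (hW : ∀ i ∈ s, W i ≠ ⊤) {U : Set E} (hU : IsOpen U)
    (hne : U.Nonempty) : ∃ x ∈ U, ∀ i ∈ s, x ∉ W i := by
  have hd : Dense (⋂ i ∈ s, ((W i : Set E)ᶜ)) := by
    refine dense_biInter_of_isOpen (fun i _ => ?_) hs.countable fun i hi => ?_
    · exact (Submodule.closed_of_finiteDimensional (W i)).isOpen_compl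
    · rw [← interior_eq_empty_iff_dense_compl]
      by_contra h
      exact hW i hi ((W i).eq_top_of_nonempty_interior' (Set.nonempty_iff_ne_empty.2 h))
  obtain ⟨x, hxU, hx⟩ := hd.inter_open_nonempty U hU hne
  exact ⟨x, hxU, fun i hi => by simpa using Set.mem_iInter₂.1 hx i hi⟩

/-- Away from the image of the codimension two skeleton of the hyperplane arrangement `L`, the
range of an injective piecewise linear map is open. -/
theorem LinearMap.range_mem_nhds_of_piecewise {g : E → E} (hg : Continuous g)
    (hinj : Function.Injective g) {F : Set (E →ₗ[ℝ] E)} (hF : F.Finite)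
    (hgF : ∀ x, ∃ M ∈ F, g x = M x) {L : Set (E →ₗ[ℝ] ℝ)} (hL : L.Finite)
    (hL0 : ∀ l ∈ L, l ≠ 0)
    (hFL : ∀ M ∈ F, ∀ N ∈ F, ∀ x, M x = N x → (∀ l ∈ L, l x ≠ 0) → M = N) {x : E}
    (hx : ∀ l ∈ L, ∀ l' ∈ L, l x = 0 → l' x = 0 → l.ker ≤ l'.ker) :
    Set.range g ∈ 𝓝 (g x) := by
  have hLc : ∀ l : E →ₗ[ℝ] ℝ, Continuous l := fun l => l.continuous_of_finiteDimensional
  obtain ⟨ε, hε, hball⟩ : ∃ ε > 0, ∀ y ∈ Metric.ball x ε, ∀ l ∈ L, l x ≠ 0 → l y ≠ 0 := by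
    have : ∀ᶠ y in 𝓝 x, ∀ l ∈ L, l x ≠ 0 → l y ≠ 0 := by
      rw [Filter.eventually_all_finite hL]
      intro l _
      by_cases h : l x = 0
      · simp [h]
      · filter_upwards [(hLc l).continuousAt.eventually_ne h] with y hy _ using hy
    exact Metric.eventually_nhds_iff_ball.1 this
  have linear_on : ∀ C : Set E, Convex ℝ C → C.Nonempty → (∀ y ∈ C, ∀ l ∈ L, l y ≠ 0) →
      ∃ M ∈ F, Set.EqOn g M C := fun C hC hne hCL =>
    hC.isPreconnected.exists_eqOn_of_pairwise_ne hF
      (fun M _ => M.continuous_of_finiteDimensional) hg hne (fun y _ => hgF y)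
      fun y hy M hM N hN h => hFL M hM N hN y h (hCL y hy)
  by_cases hex : ∃ l ∈ L, l x = 0
  · obtain ⟨l, hl, hlx⟩ := hex
    have hne : ∀ y ∈ Metric.ball x ε, l y ≠ 0 → ∀ l' ∈ L, l' y ≠ 0 := by
      intro y hy hly l' hl' hl'y
      by_cases h : l' x = 0
      · refine hL0 l' hl' (LinearMap.ext fun z => ?_)
        have hz : z - (l z / l y) • y ∈ l.ker := by simp [hly]
        simpa [hl'y] using hx l hl l' hl' hlx h hz
      · exact hball y hy l' hl' h hl'y
    obtain ⟨u, hu⟩ : ∃ u, l u = 1 := LinearMap.surjective (hL0 l hl) 1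
    have hnonempty : ∀ s : ℝ, ∃ t : ℝ, 0 < t ∧ x + t • s • u ∈ Metric.ball x ε := by
      intro s
      obtain ⟨t, h1, h2⟩ := (((tendsto_add_smul_nhdsGT_zero x (s • u)).eventually
        (Metric.ball_mem_nhds x hε)).and self_mem_nhdsWithin).exists
      exact ⟨t, h2, h1⟩
    obtain ⟨M, -, hM⟩ := linear_on (Metric.ball x ε ∩ {y | 0 < l y})
      ((convex_ball x ε).inter (convex_halfSpace_gt l.isLinear 0))
      (by
        obtain ⟨t, ht, htb⟩ := hnonempty 1
        exact ⟨_, htb, by simpa [hlx, hu] using ht⟩)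
      fun y hy => hne y hy.1 hy.2.ne'
    obtain ⟨N, -, hN⟩ := linear_on (Metric.ball x ε ∩ {y | l y < 0})
      ((convex_ball x ε).inter (convex_halfSpace_lt l.isLinear 0))
      (by
        obtain ⟨t, ht, htb⟩ := hnonempty (-1)
        exact ⟨_, htb, by simpa [hlx, hu] using ht⟩)
      fun y hy => hne y hy.1 hy.2.ne
    exact range_mem_nhds_of_eqOn_halfspaces hg hinj Metric.isOpen_ball
      (Metric.mem_ball_self hε) (hL0 l hl) hlx hM hN
  · push Not at hex
    obtain ⟨M, -, hM⟩ := linear_on (Metric.ball x ε) (convex_ball x ε)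
      ⟨x, Metric.mem_ball_self hε⟩ fun y hy l hl => hball y hy l hl (hex l hl)
    exact range_mem_nhds_of_eqOn hinj Metric.isOpen_ball (Metric.mem_ball_self hε) hM

/-- An injective piecewise linear self-map of a finite-dimensional space with closed range is
surjective. -/
theorem LinearMap.surjective_of_piecewise {g : E → E} (hg : Continuous g)
    (hinj : Function.Injective g) (hclosed : IsClosed (Set.range g)) {F : Set (E →ₗ[ℝ] E)}
    (hF : F.Finite) (hgF : ∀ x, ∃ M ∈ F, g x = M x) : Function.Surjective g := by
  have hsep : ∀ P : E →ₗ[ℝ] E, ∃ l : E →ₗ[ℝ] ℝ, P ≠ 0 → l ≠ 0 ∧ P.ker ≤ l.ker := by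
    intro P
    by_cases hP : P = 0
    · exact ⟨0, fun h => absurd hP h⟩
    · obtain ⟨l, hl, hle⟩ := P.ker.exists_le_ker_of_lt_top
        (lt_top_iff_ne_top.2 fun h => hP (LinearMap.ker_eq_top.1 h))
      exact ⟨l, fun _ => ⟨hl, hle⟩⟩
  choose φ hφ using hsep
  let L : Set (E →ₗ[ℝ] ℝ) := Set.image2 (fun M N => φ (M - N)) F F ∩ {l | l ≠ 0}
  have hL : L.Finite := (hF.image2 _ hF).subset Set.inter_subset_left
  have hL0 : ∀ l ∈ L, l ≠ 0 := fun l hl => hl.2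
  have hFL : ∀ M ∈ F, ∀ N ∈ F, ∀ x, M x = N x → (∀ l ∈ L, l x ≠ 0) → M = N := by
    intro M hM N hN x hMN hx
    by_contra hne
    obtain ⟨h0, hle⟩ := hφ (M - N) (sub_ne_zero.2 hne)
    exact hx _ ⟨⟨M, hM, N, hN, rfl⟩, h0⟩ (hle (by simp [hMN]))
  have hlocal := fun x => range_mem_nhds_of_piecewise (x := x) hg hinj hF hgF hL hL0 hFL
  obtain ⟨x₁, -, hx₁⟩ := Submodule.exists_mem_isOpen_forall_notMem hL
    (W := fun l => l.ker) (fun l hl h => hL0 l hl (LinearMap.ker_eq_top.1 h))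
    isOpen_univ Set.univ_nonempty
  have hint : (interior (Set.range g)).Nonempty :=
    ⟨g x₁, mem_interior_iff_mem_nhds.2
      (hlocal x₁ fun l hl l' _ h => absurd h (hx₁ l hl))⟩
  intro y₀
  let s : Set ((E →ₗ[ℝ] E) × (E →ₗ[ℝ] ℝ) × (E →ₗ[ℝ] ℝ)) :=
    (F ×ˢ L ×ˢ L) ∩ {p | ¬ p.2.1.ker ≤ p.2.2.ker}
  have hs : s.Finite := (hF.prod (hL.prod hL)).subset Set.inter_subset_left
  let W : (E →ₗ[ℝ] E) × (E →ₗ[ℝ] ℝ) × (E →ₗ[ℝ] ℝ) → Submodule ℝ E :=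
    fun p => (p.2.1.ker ⊓ p.2.2.ker).map p.1
  have hW : ∀ p ∈ s, W p ⊔ Submodule.span ℝ {y₀} ≠ ⊤ := by
    rintro ⟨M, l, l'⟩ ⟨⟨-, hl, -⟩, hll'⟩ htop
    have h1 : Module.finrank ℝ (W (M, l, l')) ≤
        Module.finrank ℝ (l.ker ⊓ l'.ker : Submodule ℝ E) := Submodule.finrank_map_le _ _
    have h2 : Module.finrank ℝ (l.ker ⊓ l'.ker : Submodule ℝ E) < Module.finrank ℝ l.ker :=
      Submodule.finrank_lt_finrank_of_lt (inf_lt_left.2 hll')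
    have h3 : Module.finrank ℝ l.ker < Module.finrank ℝ E :=
      Submodule.finrank_lt fun h => hL0 l hl (LinearMap.ker_eq_top.1 h)
    have h4 := Submodule.finrank_add_le_finrank_add_finrank (W (M, l, l'))
      (Submodule.span ℝ {y₀})
    have h5 : Module.finrank ℝ (Submodule.span ℝ {y₀}) ≤ 1 := (finrank_span_le_card _).trans (by simp)
    rw [htop, finrank_top] at h4
    omega
  obtain ⟨y₁, hy₁, hy₁W⟩ :=
    Submodule.exists_mem_isOpen_forall_notMem hs hW isOpen_interior hint
  let γ : ℝ → E := fun t => (1 - t) • y₁ + t • y₀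
  have hγ : Continuous γ := by fun_prop
  have hopen : ∀ t ∈ Set.Ico (0 : ℝ) 1, γ t ∈ Set.range g → γ t ∈ interior (Set.range g) := by
    rintro t ht ⟨x, hx⟩
    rw [← hx, mem_interior_iff_mem_nhds]
    refine hlocal x fun l hl l' hl' hlx hlx' => ?_
    by_contra hll'
    obtain ⟨M, hM, hMx⟩ := hgF x
    refine hy₁W (M, l, l') ⟨⟨hM, hl, hl'⟩, hll'⟩ ?_
    have hmem : γ t ∈ W (M, l, l') := ⟨x, ⟨hlx, hlx'⟩, by rw [← hx, hMx]⟩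
    have h0 : 1 - t ≠ 0 := (sub_pos.2 ht.2).ne'
    refine (Submodule.smul_mem_iff _ h0).1 ?_
    rw [show (1 - t) • y₁ = γ t + (-t) • y₀ by simp only [γ]; module]
    exact Submodule.add_mem_sup hmem
      (Submodule.smul_mem _ _ (Submodule.mem_span_singleton_self y₀))
  have hsub : Set.Ico (0 : ℝ) 1 ⊆ γ ⁻¹' interior (Set.range g) := by
    refine isPreconnected_Ico.subset_of_closure_inter_subset (isOpen_interior.preimage hγ)
      ⟨0, by simp, by simpa [γ] using hy₁⟩ ?_
    rintro t ⟨htc, ht⟩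
    refine hopen t ht ?_
    exact closure_minimal (Set.preimage_mono interior_subset) (hclosed.preimage hγ) htc
  have h1 : (1 : ℝ) ∈ closure (Set.Ico (0 : ℝ) 1) := by
    rw [closure_Ico zero_ne_one]; simp
  have := closure_minimal (hsub.trans (Set.preimage_mono interior_subset))
    (hclosed.preimage hγ) h1
  simpa [γ] using this

end PiecewiseLinear

/-- every `n`-element generating set `g_1, …, g_n` of the free
`n`-generator ℓ-group `A_n` is a free generating set: the induced ℓ-endomorphism
`f ↦ f ∘ g`, where `g(x) = (g_1(x), …, g_n(x))`, is a bijection of `A_n` onto itself. -/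
theorem stmt17 {n : ℕ} (hn : 1 ≤ n) (gs : Fin n → ((Fin n → ℝ) → ℝ))
    (hgs : ∀ i, gs i ∈ Afree n)
    (hgen : ∀ S : Set ((Fin n → ℝ) → ℝ), S ⊆ Afree n →
      (∀ i, gs i ∈ S) → (0 : (Fin n → ℝ) → ℝ) ∈ S →
      (∀ f ∈ S, ∀ g ∈ S, f + g ∈ S) → (∀ f ∈ S, -f ∈ S) →
      (∀ f ∈ S, ∀ g ∈ S, f ⊔ g ∈ S) → (∀ f ∈ S, ∀ g ∈ S, f ⊓ g ∈ S) →
      Afree n ⊆ S) :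
    Set.BijOn (fun f : (Fin n → ℝ) → ℝ => fun x => f (fun i => gs i x))
      (Afree n) (Afree n) := by
  have hmaps : Set.MapsTo (fun f : (Fin n → ℝ) → ℝ => fun x => f (fun i => gs i x))
      (Afree n) (Afree n) := fun f hf => Afree.comp_mem hf hgs
  have hsurj : Set.SurjOn (fun f : (Fin n → ℝ) → ℝ => fun x => f (fun i => gs i x))
      (Afree n) (Afree n) := by
    refine hgen _ hmaps.image_subset (fun i => ⟨_, Afree.coord_mem i, rfl⟩)
      ⟨0, Afree.zero_mem, rfl⟩ ?_ ?_ ?_ ?_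
    · rintro _ ⟨f, hf, rfl⟩ _ ⟨g, hg, rfl⟩
      exact ⟨f + g, Afree.add_mem hf hg, rfl⟩
    · rintro _ ⟨f, hf, rfl⟩
      exact ⟨-f, Afree.neg_mem hf, rfl⟩
    · rintro _ ⟨f, hf, rfl⟩ _ ⟨g, hg, rfl⟩
      exact ⟨f ⊔ g, Afree.sup_mem hf hg, rfl⟩
    · rintro _ ⟨f, hf, rfl⟩ _ ⟨g, hg, rfl⟩
      exact ⟨f ⊓ g, Afree.inf_mem hf hg, rfl⟩
  choose hs hhs hhs_eq using fun i => hsurj (Afree.coord_mem (n := n) i)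
  let g : (Fin n → ℝ) → (Fin n → ℝ) := fun x i => gs i x
  let h : (Fin n → ℝ) → (Fin n → ℝ) := fun y i => hs i y
  have hg : Continuous g := continuous_pi fun i => (hgs i).1
  have hh : Continuous h := continuous_pi fun i => (hhs i).1
  have hleft : Function.LeftInverse h g := fun x => funext fun i => congrFun (hhs_eq i) x
  obtain ⟨F, hF, hgF⟩ := Afree.exists_finite_matrix hgs
  have hgsurj : Function.Surjective g := by
    refine LinearMap.surjective_of_piecewise hg hleft.injective
      (hleft.isClosed_range hh hg)
      (hF.image fun d => Matrix.mulVecLin (Matrix.of fun i j => (d i j : ℝ))) fun x => ?_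
    obtain ⟨d, hd, hdx⟩ := hgF x
    exact ⟨_, ⟨d, hd, rfl⟩, funext fun i => hdx i⟩
  refine ⟨hmaps, fun f _ f' _ hff' => funext fun y => ?_, hsurj⟩
  obtain ⟨x, rfl⟩ := hgsurj y
  exact congrFun hff' x
end

section
/- For all n ≥ 1, the free n-generator ℓ-group A_n is hopfian: every surjective ℓ-endomorphism of A_n is injective. -/
open Set BigOperators

open Filter Topology Module

variable {E F : Type*} [NormedAddCommGroup E] [NormedSpace ℝ E]
  [NormedAddCommGroup F] [NormedSpace ℝ F]

/-- A continuous map which at every point agrees with one of finitely many linear maps. -/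
structure IsPiecewiseLinear (φ : E → F) : Prop where
  continuous : Continuous φ
  exists_selection : ∃ s : Set (E →ₗ[ℝ] F), s.Finite ∧ ∀ x, ∃ L ∈ s, φ x = L x

/-- Near `x`, only linear pieces that agree with `φ` at `x` are active. -/
theorem eventually_active [FiniteDimensional ℝ E] {φ : E → F} (hφ : Continuous φ)
    {s : Set (E →ₗ[ℝ] F)} (hs : s.Finite) (x : E) :
    ∀ᶠ y in 𝓝 x, ∀ L ∈ s, φ y = L y → φ x = L x := by
  refine (eventually_all_finite hs).2 fun L _ => ?_
  by_cases h : φ x = L x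
  · exact Eventually.of_forall fun _ _ => h
  · filter_upwards [(isOpen_ne_fun hφ L.continuous_of_finiteDimensional).mem_nhds h] with y hy hy'
    exact absurd hy' hy

/-- A continuous selection of finitely many linear maps is homogeneous along a ray. -/
theorem map_smul_of_selection {g : E → F} {v : E}
    (hg : ContinuousOn (fun t : ℝ => g (t • v)) (Ioc 0 1)) {s : Set (E →ₗ[ℝ] F)} (hs : s.Finite)
    (hsel : ∀ t ∈ Ioc (0 : ℝ) 1, ∃ L ∈ s, g (t • v) = L (t • v)) {t : ℝ} (ht : t ∈ Ioc (0 : ℝ) 1) :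
    g (t • v) = t • g v := by
  have hfin : ((fun L : E →ₗ[ℝ] F => L v) '' s).Finite := hs.image _
  have := hfin.to_subtype
  have hc : ContinuousOn (fun t : ℝ => t⁻¹ • g (t • v)) (Ioc 0 1) :=
    (continuousOn_id.inv₀ fun t ht => ht.1.ne').smul hg
  have hm : MapsTo (fun t : ℝ => t⁻¹ • g (t • v)) (Ioc 0 1) ((fun L : E →ₗ[ℝ] F => L v) '' s) := by
    intro t ht
    obtain ⟨L, hL, h⟩ := hsel t ht
    refine ⟨L, hL, ?_⟩
    simp only [h, map_smul, inv_smul_smul₀ ht.1.ne']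
  have key := isPreconnected_Ioc.constant_of_mapsTo
    (isDiscrete_iff_discreteTopology.2 inferInstance) hc hm ht (right_mem_Ioc.2 zero_lt_one)
  simp only [inv_one, one_smul] at key
  rw [← key, smul_inv_smul₀ ht.1.ne']

namespace IsPiecewiseLinear

variable {φ : E → F}

theorem map_zero (hφ : IsPiecewiseLinear φ) : φ 0 = 0 := by
  obtain ⟨s, -, h⟩ := hφ.exists_selection
  obtain ⟨L, -, hL⟩ := h 0
  simpa using hL

theorem map_smul (hφ : IsPiecewiseLinear φ) {t : ℝ} (ht : 0 ≤ t) (v : E) :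
    φ (t • v) = t • φ v := by
  obtain ⟨s, hs, h⟩ := hφ.exists_selection
  have hc := hφ.continuous
  have small : ∀ t ∈ Ioc (0 : ℝ) 1, ∀ v, φ (t • v) = t • φ v := fun t ht v =>
    map_smul_of_selection (by fun_prop) hs (fun t _ => h (t • v)) ht
  rcases ht.eq_or_lt with rfl | ht
  · simp [hφ.map_zero]
  rcases le_total t 1 with h1 | h1
  · exact small t ⟨ht, h1⟩ v
  · have := small t⁻¹ ⟨inv_pos.2 ht, inv_le_one_of_one_le₀ h1⟩ (t • v)
    rw [inv_smul_smul₀ ht.ne'] at this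
    rw [this, smul_inv_smul₀ ht.ne']

/-- A piecewise linear map has a piecewise linear derivative at every point. -/
theorem exists_germ [FiniteDimensional ℝ E] (hφ : IsPiecewiseLinear φ) (x : E) :
    ∃ D : E → F, IsPiecewiseLinear D ∧ ∀ᶠ v in 𝓝 0, φ (x + v) = φ x + D v := by
  obtain ⟨s, hs, h⟩ := hφ.exists_selection
  have hc := hφ.continuous
  obtain ⟨r, hr, hball⟩ := Metric.eventually_nhds_iff.1 (eventually_active hc hs x)
  have hsel : ∀ v, ‖v‖ < r → ∃ L ∈ s, φ (x + v) - φ x = L v := by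
    intro v hv
    obtain ⟨L, hL, hLv⟩ := h (x + v)
    refine ⟨L, hL, ?_⟩
    rw [hball (by simpa using hv) L hL hLv, hLv, map_add, add_sub_cancel_left]
  have hhom : ∀ t ∈ Ioc (0 : ℝ) 1, ∀ v, ‖v‖ < r → φ (x + t • v) - φ x = t • (φ (x + v) - φ x) := by
    intro t ht v hv
    refine map_smul_of_selection (g := fun v => φ (x + v) - φ x) (by fun_prop) hs
      (fun t ht => hsel _ ?_) ht
    rw [norm_smul, Real.norm_of_nonneg ht.1.le]
    exact (mul_le_of_le_one_left (norm_nonneg v) ht.2).trans_lt hv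
  set c : E → ℝ := fun v => min r 1 / (1 + ‖v‖) with hcdef
  have hpos : ∀ v : E, 0 < 1 + ‖v‖ := fun v => by positivity
  have hc0 : ∀ v, 0 < c v := fun v => div_pos (lt_min hr one_pos) (hpos v)
  have hcr : ∀ v, ‖c v • v‖ < r := by
    intro v
    rw [norm_smul, Real.norm_of_nonneg (hc0 v).le, hcdef, div_mul_eq_mul_div, div_lt_iff₀ (hpos v)]
    have := mul_le_mul_of_nonneg_right (min_le_left r 1) (norm_nonneg v)
    linarith
  have hc1 : ∀ v, c v ≤ 1 := by
    intro v
    rw [hcdef, div_le_one (hpos v)]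
    linarith [min_le_right r 1, norm_nonneg v]
  have hcc : Continuous c := continuous_const.div (by fun_prop) fun v => (hpos v).ne'
  refine ⟨fun v => (c v)⁻¹ • (φ (x + c v • v) - φ x), ⟨?_, s, hs, fun v => ?_⟩, ?_⟩
  · exact (hcc.inv₀ fun v => (hc0 v).ne').smul (by fun_prop)
  · obtain ⟨L, hL, hLv⟩ := hsel _ (hcr v)
    exact ⟨L, hL, by rw [hLv, LinearMap.map_smul, inv_smul_smul₀ (hc0 v).ne']⟩
  · refine Metric.eventually_nhds_iff.2 ⟨r, hr, fun v hv => ?_⟩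
    beta_reduce
    rw [hhom (c v) ⟨hc0 v, hc1 v⟩ v (by simpa using hv), inv_smul_smul₀ (hc0 v).ne',
      add_sub_cancel]

theorem exists_mul_norm_le [FiniteDimensional ℝ E] (hφ : IsPiecewiseLinear φ)
    (hinj : Function.Injective φ) : ∃ c > 0, ∀ v, c * ‖v‖ ≤ ‖φ v‖ := by
  rcases (Metric.sphere (0 : E) 1).eq_empty_or_nonempty with he | hne
  · refine ⟨1, one_pos, fun v => ?_⟩
    suffices v = 0 by simp [this, hφ.map_zero]
    by_contra hv
    have : ‖v‖⁻¹ • v ∈ Metric.sphere (0 : E) 1 := by simp [norm_smul, hv]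
    simp [he] at this
  have hc := hφ.continuous
  obtain ⟨u, hu, hmin⟩ := (isCompact_sphere (0 : E) 1).exists_isMinOn hne
    (f := fun v => ‖φ v‖) (by fun_prop)
  refine ⟨‖φ u‖, norm_pos_iff.2 fun h => ?_, fun v => ?_⟩
  · rw [hinj (h.trans hφ.map_zero.symm)] at hu
    simp at hu
  · rcases eq_or_ne v 0 with rfl | hv
    · simp
    have hv' : 0 < ‖v‖ := norm_pos_iff.2 hv
    have : ‖φ u‖ ≤ ‖φ (‖v‖⁻¹ • v)‖ := hmin (by simp [norm_smul, hv])
    rw [hφ.map_smul (by positivity), norm_smul, norm_inv, norm_norm, inv_mul_eq_div,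
      le_div_iff₀ hv'] at this
    exact this

theorem isClosed_range [FiniteDimensional ℝ E] [FiniteDimensional ℝ F]
    (hφ : IsPiecewiseLinear φ) (hinj : Function.Injective φ) : IsClosed (Set.range φ) := by
  obtain ⟨c, hc, hle⟩ := hφ.exists_mul_norm_le hinj
  have : ProperSpace E := FiniteDimensional.proper_real E
  have : ProperSpace F := FiniteDimensional.proper_real F
  refine (isProperMap_iff_tendsto_cocompact.mpr ⟨hφ.continuous, ?_⟩).isClosedMap.isClosed_range
  rw [← Metric.cobounded_eq_cocompact (α := F), ← tendsto_norm_atTop_iff_cobounded]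
  exact tendsto_atTop_mono hle ((tendsto_norm_cocompact_atTop (E := E)).const_mul_atTop hc)

/-- A bijective piecewise linear map sends neighbourhoods of `0` to neighbourhoods of `0`. -/
theorem image_mem_nhds_zero [FiniteDimensional ℝ E] (hφ : IsPiecewiseLinear φ)
    (hbij : Function.Bijective φ) {U : Set E} (hU : U ∈ 𝓝 0) : φ '' U ∈ 𝓝 0 := by
  obtain ⟨c, hc, hle⟩ := hφ.exists_mul_norm_le hbij.1
  obtain ⟨r, hr, hball⟩ := Metric.mem_nhds_iff.1 hU
  refine Metric.mem_nhds_iff.2 ⟨c * r, by positivity, fun y hy => ?_⟩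
  obtain ⟨v, rfl⟩ := hbij.2 y
  refine ⟨v, hball ?_, rfl⟩
  rw [mem_ball_zero_iff] at hy ⊢
  exact lt_of_mul_lt_mul_left ((hle v).trans_lt hy) hc.le

end IsPiecewiseLinear

theorem germ_injective {φ D : E → F} (hD : IsPiecewiseLinear D) (hinj : Function.Injective φ)
    {x : E} (hgerm : ∀ᶠ v in 𝓝 0, φ (x + v) = φ x + D v) : Function.Injective D := by
  intro v w hvw
  have ht : ∀ v : E, Tendsto (fun t : ℝ => t • v) (𝓝[>] 0) (𝓝 0) := fun v =>
    tendsto_nhdsWithin_of_tendsto_nhds (Continuous.tendsto' (by fun_prop) _ _ (by simp))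
  obtain ⟨t, hv, hw, ht⟩ := (((ht v).eventually hgerm).and
    (((ht w).eventually hgerm).and self_mem_nhdsWithin)).exists
  have ht : 0 < t := ht
  have : φ (x + t • v) = φ (x + t • w) := by
    rw [hv, hw, hD.map_smul ht.le, hD.map_smul ht.le, hvw]
  exact smul_right_injective E ht.ne' (add_left_cancel (hinj this))

/-- The germ of `φ` at `x` is additive along every direction along which `φ` is, and
along `x`. -/
theorem germ_map_add {φ D : E → F} (hφ : IsPiecewiseLinear φ) (hD : IsPiecewiseLinear D)
    {x : E} (hgerm : ∀ᶠ v in 𝓝 0, φ (x + v) = φ x + D v) {w : E}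
    (hw : ∀ (t : ℝ) (v : E), φ (v + t • w) = φ v + t • φ w) (a : ℝ) (v : E) :
    D (v + (w + a • x)) = D v + (φ w + a • φ x) := by
  have ht : Tendsto (fun t : ℝ => t • (v + (w + a • x))) (𝓝[>] 0) (𝓝 0) :=
    tendsto_nhdsWithin_of_tendsto_nhds (Continuous.tendsto' (by fun_prop) _ _ (by simp))
  have hpos : ∀ᶠ t : ℝ in 𝓝[>] 0, 0 < 1 + t * a := by
    refine nhdsWithin_le_nhds (ContinuousAt.eventually_lt (by fun_prop) (by fun_prop) (by simp))
  have ht' : Tendsto (fun t : ℝ => (t / (1 + t * a)) • v) (𝓝[>] 0) (𝓝 0) := by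
    refine tendsto_nhdsWithin_of_tendsto_nhds ?_
    have : ContinuousAt (fun t : ℝ => (t / (1 + t * a)) • v) 0 :=
      (ContinuousAt.div (by fun_prop) (by fun_prop) (by simp)).smul continuousAt_const
    simpa [ContinuousAt] using this
  obtain ⟨t, h1, h2, h3, ht⟩ := ((ht.eventually hgerm).and ((ht'.eventually hgerm).and
    (hpos.and self_mem_nhdsWithin))).exists
  have ht : 0 < t := ht
  have e : x + t • (v + (w + a • x)) =
      (1 + t * a) • (x + (t / (1 + t * a)) • v) + t • w := by
    rw [smul_add (1 + t * a), smul_smul, mul_div_cancel₀ _ h3.ne']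
    module
  rw [e, hw, hφ.map_smul h3.le, h2, smul_add, hD.map_smul (by positivity), smul_smul,
    mul_div_cancel₀ _ h3.ne', hD.map_smul ht.le] at h1
  have h4 : t • D (v + (w + a • x)) = t • (D v + (φ w + a • φ x)) := by
    rw [← add_left_cancel_iff (a := φ x), ← h1]
    module
  exact smul_right_injective F ht.ne' h4

namespace IsPiecewiseLinear

theorem map_add_smul {φ : E → F} (hφ : IsPiecewiseLinear φ) {W : Submodule ℝ E}
    (hW : ∀ w ∈ W, ∀ v, φ (v + w) = φ v + φ w) {w : E} (hw : w ∈ W) (t : ℝ) (v : E) :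
    φ (v + t • w) = φ v + t • φ w := by
  rw [hW _ (W.smul_mem t hw)]
  congr 1
  rcases le_total 0 t with ht | ht
  · exact hφ.map_smul ht w
  · have h := hW _ (W.smul_mem t hw) (-(t • w))
    rw [neg_add_cancel, hφ.map_zero, ← neg_smul, hφ.map_smul (neg_nonneg.2 ht), neg_smul] at h
    exact (neg_add_eq_zero.1 h.symm).symm

/-- A piecewise linear injective endomorphism, additive along `W`, is surjective. -/
theorem surjective_of_finrank_le [FiniteDimensional ℝ E] (k : ℕ) :
    ∀ {φ : E → E} (W : Submodule ℝ E), IsPiecewiseLinear φ → Function.Injective φ →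
      (∀ w ∈ W, ∀ v, φ (v + w) = φ v + φ w) → finrank ℝ E ≤ finrank ℝ W + k →
      Function.Surjective φ := by
  induction k with
  | zero =>
    intro φ W hφ hinj hW hk
    have hT : W = ⊤ := Submodule.eq_top_of_finrank_eq (le_antisymm W.finrank_le hk)
    subst hT
    let L : E →ₗ[ℝ] E :=
      { toFun := φ
        map_add' := fun v w => hW w trivial v
        map_smul' := fun t w => by
          simpa [hφ.map_zero] using hφ.map_add_smul hW (w := w) trivial t 0 }
    exact LinearMap.injective_iff_surjective (f := L).1 hinj
  | succ k ih =>
    intro φ W hφ hinj hW hk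
    by_cases hWT : W = ⊤
    · exact ih W hφ hinj hW (by rw [hWT, finrank_top]; omega)
    obtain ⟨x, hx⟩ : ∃ x, x ∉ W := by
      by_contra! h
      exact hWT (Submodule.eq_top_iff'.2 h)
    let L : W →ₗ[ℝ] E :=
      { toFun := fun w => φ w
        map_add' := fun v w => hW w w.2 v
        map_smul' := fun t w => by
          simpa [hφ.map_zero] using hφ.map_add_smul hW w.2 t 0 }
    have hHrank : finrank ℝ (LinearMap.range L) = finrank ℝ W :=
      LinearMap.finrank_range_of_inj fun v w h => Subtype.ext (hinj h)
    have hH : ∀ v, φ v ∈ LinearMap.range L → v ∈ W := by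
      rintro v ⟨w, hw⟩
      rw [← hinj hw]
      exact w.2
    have hHx : φ x ∉ LinearMap.range L := fun h => hx (hH x h)
    by_cases hcodim : finrank ℝ E ≤ finrank ℝ W + 1
    · -- codimension one
      have hsplit : ∀ y, ∃ w ∈ W, ∃ b : ℝ, y = φ w + b • φ x := by
        have htop : LinearMap.range L ⊔ ℝ ∙ φ x = ⊤ := by
          refine Submodule.eq_top_of_finrank_eq (le_antisymm (Submodule.finrank_le _) ?_)
          rwa [Submodule.finrank_sup_span_singleton hHx, hHrank]
        intro y
        have hy : y ∈ LinearMap.range L ⊔ ℝ ∙ φ x := htop ▸ Submodule.mem_top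
        obtain ⟨_, ⟨w, rfl⟩, _, hz, rfl⟩ := Submodule.mem_sup.1 hy
        obtain ⟨b, rfl⟩ := Submodule.mem_span_singleton.1 hz
        exact ⟨w, w.2, b, rfl⟩
      obtain ⟨w₀, hw₀, a, ha⟩ := hsplit (φ (-x))
      have ha0 : a < 0 := by
        by_contra! h
        rw [add_comm, ← hφ.map_smul h, ← hW _ hw₀] at ha
        have h1 : (1 + a) • x = -w₀ := by
          linear_combination (norm := module) - hinj ha
        have h2 : (1 + a)⁻¹ • ((1 + a) • x) ∈ W :=
          W.smul_mem _ (h1 ▸ W.neg_mem hw₀)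
        rw [inv_smul_smul₀ (by positivity)] at h2
        exact hx h2
      intro y
      obtain ⟨w, hw, b, rfl⟩ := hsplit y
      rcases le_total 0 b with hb | hb
      · exact ⟨b • x + w, by rw [hW _ hw, hφ.map_smul hb, add_comm]⟩
      · refine ⟨((b / a) • (-x) + w) + (-(b / a)) • w₀, ?_⟩
        rw [hφ.map_add_smul hW hw₀, hW _ hw, hφ.map_smul (div_nonneg_of_nonpos hb ha0.le), ha,
          smul_add, smul_smul, div_mul_cancel₀ _ ha0.ne]
        module
    · -- codimension at least two
      push Not at hcodim
      have hopen : IsOpen (φ '' (W : Set E)ᶜ) := by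
        rw [isOpen_iff_mem_nhds]
        rintro _ ⟨z, hz, rfl⟩
        obtain ⟨D, hD, hgerm⟩ := hφ.exists_germ z
        have hDinj := germ_injective hD hinj hgerm
        have hDadd : ∀ w ∈ W ⊔ ℝ ∙ z, ∀ v, D (v + w) = D v + D w := by
          intro u hu v
          obtain ⟨w, hw, _, hu', rfl⟩ := Submodule.mem_sup.1 hu
          obtain ⟨a, rfl⟩ := Submodule.mem_span_singleton.1 hu'
          have key := germ_map_add hφ hD hgerm (hφ.map_add_smul hW hw) a
          have h0 := key 0
          rw [zero_add, hD.map_zero, zero_add] at h0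
          rw [key, h0]
        have hDsurj := ih _ hD hDinj hDadd (by
          rw [Submodule.finrank_sup_span_singleton hz]; omega)
        have hU : {v | φ (z + v) = φ z + D v ∧ z + v ∈ (W : Set E)ᶜ} ∈ 𝓝 (0 : E) := by
          refine hgerm.and ?_
          have : Tendsto (fun v => z + v) (𝓝 0) (𝓝 z) :=
            Continuous.tendsto' (by fun_prop) _ _ (by simp)
          exact this.eventually (W.closed_of_finiteDimensional.isOpen_compl.mem_nhds hz)
        have h1 := hD.image_mem_nhds_zero ⟨hDinj, hDsurj⟩ hU
        have h2 : Tendsto (fun y => y - φ z) (𝓝 (φ z)) (𝓝 0) :=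
          Continuous.tendsto' (by fun_prop) _ _ (by simp)
        filter_upwards [h2 h1] with y hy
        obtain ⟨v, ⟨hv1, hv2⟩, hv⟩ := hy
        exact ⟨z + v, hv2, by rw [hv1, hv, add_sub_cancel]⟩
      have hconn : IsPreconnected ((LinearMap.range L : Set E)ᶜ) := by
        refine (isConnected_compl_of_one_lt_codim ?_).isPreconnected
        rw [← finrank_eq_rank, ← Nat.cast_one, Nat.cast_lt]
        have := (LinearMap.range L).finrank_quotient_add_finrank
        omega
      have hsub := hconn.subset_of_closure_inter_subset hopen ⟨φ x, hHx, x, hx, rfl⟩ (by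
        rintro y ⟨hy, hyH⟩
        obtain ⟨v, rfl⟩ := closure_minimal (image_subset_range _ _) (hφ.isClosed_range hinj) hy
        exact ⟨v, fun hv => hyH ⟨⟨v, hv⟩, rfl⟩, rfl⟩)
      intro y
      by_cases hy : y ∈ LinearMap.range L
      · obtain ⟨w, hw⟩ := hy
        exact ⟨w, hw⟩
      · obtain ⟨v, -, hv⟩ := hsub hy
        exact ⟨v, hv⟩

theorem surjective_of_injective [FiniteDimensional ℝ E] {φ : E → E} (hφ : IsPiecewiseLinear φ)
    (hinj : Function.Injective φ) : Function.Surjective φ :=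
  surjective_of_finrank_le (finrank ℝ E) ⊥ hφ hinj
    (fun w hw v => by rw [(Submodule.mem_bot ℝ).1 hw, add_zero, hφ.map_zero, add_zero])
    (by simp)

end IsPiecewiseLinear

/-- Between any two points, a continuous selection of linear functionals has a piece lying above
it at the first point and below it at the second. -/
theorem exists_le_and_le_of_selection [FiniteDimensional ℝ E] {f : E → ℝ} (hf : Continuous f)
    {s : Set (E →ₗ[ℝ] ℝ)} (hs : s.Finite) (hsel : ∀ x, ∃ L ∈ s, f x = L x) (x y : E) :
    ∃ L ∈ s, f x ≤ L x ∧ L y ≤ f y := by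
  set γ : ℝ → E := fun t => x + t • (y - x) with hγ
  have hγc : Continuous γ := by fun_prop
  have hLγ : ∀ (L : E →ₗ[ℝ] ℝ) t, L (γ t) = L x + t * (L y - L x) := fun L t => by simp [hγ]
  set T : Set ℝ := {t | ∃ L ∈ s, f x ≤ L x ∧ L (γ t) ≤ f (γ t)} with hT
  suffices Icc (0 : ℝ) 1 ⊆ T by simpa [hT, hγ] using this (right_mem_Icc.2 zero_le_one)
  have hTclosed : IsClosed T := by
    have : T = ⋃ L ∈ s, {t | f x ≤ L x ∧ L (γ t) ≤ f (γ t)} := by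
      ext t
      simp only [hT, Set.mem_ofPred_eq, Set.mem_iUnion, exists_prop]
    rw [this]
    refine hs.isClosed_biUnion fun L _ => isClosed_const.and
      (isClosed_le (L.continuous_of_finiteDimensional.comp hγc) (hf.comp hγc))
  refine (hTclosed.inter isClosed_Icc).Icc_subset_of_forall_exists_gt ?_ ?_
  · obtain ⟨L, hL, h⟩ := hsel x
    exact ⟨L, hL, h.le, by simp [hγ, h]⟩
  rintro t ⟨⟨L, hL, hLx, hLt⟩, ht0, -⟩ b hb
  have hev : ∀ᶠ r in 𝓝[>] t, ∀ K ∈ s, f (γ r) = K (γ r) → f (γ t) = K (γ t) :=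
    nhdsWithin_le_nhds ((hγc.tendsto t).eventually (eventually_active hf hs (γ t)))
  obtain ⟨r, hr, hrb⟩ := (hev.and (Ioc_mem_nhdsGT hb)).exists
  refine ⟨r, ?_, hrb⟩
  obtain ⟨K, hK, hKr⟩ := hsel (γ r)
  rcases le_total (L (γ r)) (K (γ r)) with h | h
  · exact ⟨L, hL, hLx, h.trans_eq hKr.symm⟩
  refine ⟨K, hK, hLx.trans ?_, hKr.ge⟩
  have h1 := hLt.trans_eq (hr K hK hKr)
  rw [hLγ, hLγ] at h h1
  have htr : t < r := hrb.1
  by_contra! hlt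
  nlinarith [mul_le_mul_of_nonneg_left h ht0, mul_le_mul_of_nonneg_left h1 (ht0.trans htr.le),
    mul_pos (sub_pos.2 hlt) (sub_pos.2 htr)]

theorem IsHomLinZ.exists_linearMap {n : ℕ} {p : (Fin n → ℝ) → ℝ} (hp : IsHomLinZ p) :
    ∃ L : (Fin n → ℝ) →ₗ[ℝ] ℝ, ⇑L = p := by
  obtain ⟨c, hc⟩ := hp
  exact ⟨∑ i, (c i : ℝ) • LinearMap.proj i, funext fun x => by simp [hc]⟩

theorem mem_Afree_iff {n : ℕ} {f : (Fin n → ℝ) → ℝ} :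
    f ∈ Afree n ↔ Continuous f ∧ ∃ s : Set ((Fin n → ℝ) →ₗ[ℝ] ℝ), s.Finite ∧
      (∀ L ∈ s, IsHomLinZ L) ∧ ∀ x, ∃ L ∈ s, f x = L x := by
  refine and_congr_right fun _ => ⟨?_, ?_⟩
  · rintro ⟨u, p, hp, h⟩
    choose L hL using fun j => (hp j).exists_linearMap
    refine ⟨Set.range L, Set.finite_range L, ?_, fun x => ?_⟩
    · rintro _ ⟨j, rfl⟩
      exact hL j ▸ hp j
    · obtain ⟨j, hj⟩ := h x
      exact ⟨L j, ⟨j, rfl⟩, by rw [hj, hL]⟩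
  · rintro ⟨s, hs, hp, h⟩
    have := hs.fintype
    refine ⟨Fintype.card s, fun j => ((Fintype.equivFin s).symm j : (Fin n → ℝ) →ₗ[ℝ] ℝ),
      fun j => hp _ (Subtype.coe_prop _), fun x => ?_⟩
    obtain ⟨L, hL, hx⟩ := h x
    exact ⟨Fintype.equivFin s ⟨L, hL⟩, by simpa using hx⟩

theorem linearMap_mem_Afree {n : ℕ} {L : (Fin n → ℝ) →ₗ[ℝ] ℝ} (hL : IsHomLinZ L) :
    ⇑L ∈ Afree n :=
  mem_Afree_iff.2 ⟨L.continuous_of_finiteDimensional, {L}, Set.finite_singleton L,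
    by simpa using hL, by simp⟩

theorem isHomLinZ_proj {n : ℕ} (i : Fin n) :
    IsHomLinZ (LinearMap.proj i : (Fin n → ℝ) →ₗ[ℝ] ℝ) :=
  ⟨Pi.single i 1, fun x => by simp [Pi.single_apply]⟩

theorem inf_mem_Afree {n : ℕ} {f g : (Fin n → ℝ) → ℝ} (hf : f ∈ Afree n) (hg : g ∈ Afree n) :
    f ⊓ g ∈ Afree n := by
  rw [mem_Afree_iff] at *
  obtain ⟨hfc, s, hs, hsZ, hfs⟩ := hf
  obtain ⟨hgc, t, ht, htZ, hgt⟩ := hg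
  refine ⟨hfc.inf hgc, s ∪ t, hs.union ht, ?_, fun x => ?_⟩
  · rintro L (hL | hL)
    exacts [hsZ L hL, htZ L hL]
  · rcases le_total (f x) (g x) with h | h
    · obtain ⟨L, hL, hx⟩ := hfs x
      exact ⟨L, Or.inl hL, by simpa [h] using hx⟩
    · obtain ⟨L, hL, hx⟩ := hgt x
      exact ⟨L, Or.inr hL, by simpa [h] using hx⟩

/-- The additive group underlying `A_n`. -/
def afreeAddSubgroup (n : ℕ) : AddSubgroup ((Fin n → ℝ) → ℝ) where
  carrier := Afree n
  zero_mem' := mem_Afree_iff.2 ⟨continuous_zero, {0}, Set.finite_singleton 0,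
    by simpa using ⟨0, by simp⟩, by simp⟩
  add_mem' := by
    intro f g hf hg
    rw [mem_Afree_iff] at *
    obtain ⟨hfc, s, hs, hsZ, hfs⟩ := hf
    obtain ⟨hgc, t, ht, htZ, hgt⟩ := hg
    refine ⟨hfc.add hgc, Set.image2 (· + ·) s t, hs.image2 _ ht, ?_, fun x => ?_⟩
    · rintro _ ⟨L, hL, K, hK, rfl⟩
      obtain ⟨c, hc⟩ := hsZ L hL
      obtain ⟨d, hd⟩ := htZ K hK
      exact ⟨c + d, fun x => by simp [hc, hd, add_mul, Finset.sum_add_distrib]⟩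
    · obtain ⟨L, hL, hx⟩ := hfs x
      obtain ⟨K, hK, hx'⟩ := hgt x
      exact ⟨L + K, ⟨L, hL, K, hK, rfl⟩, by simp [hx, hx']⟩
  neg_mem' := by
    intro f hf
    rw [mem_Afree_iff] at *
    obtain ⟨hfc, s, hs, hsZ, hfs⟩ := hf
    refine ⟨hfc.neg, (fun L => -L) '' s, hs.image _, ?_, fun x => ?_⟩
    · rintro _ ⟨L, hL, rfl⟩
      obtain ⟨c, hc⟩ := hsZ L hL
      exact ⟨-c, fun x => by simp [hc]⟩
    · obtain ⟨L, hL, hx⟩ := hfs x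
      exact ⟨-L, ⟨L, hL, rfl⟩, by simp [hx]⟩

section Endomorphism

variable {n : ℕ} {σ : ((Fin n → ℝ) → ℝ) → ((Fin n → ℝ) → ℝ)}

theorem map_neg_of_map_add (hadd : ∀ f ∈ Afree n, ∀ g ∈ Afree n, σ (f + g) = σ f + σ g)
    {f : (Fin n → ℝ) → ℝ} (hf : f ∈ Afree n) : σ (-f) = -σ f :=
  map_neg (AddMonoidHom.mk' (fun f : afreeAddSubgroup n => σ f)
    fun f g => hadd f f.2 g g.2) ⟨f, hf⟩

/-- The map of `ℝ^n` dual to an endomorphism `σ` of `A_n`. -/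
def dualMap (σ : ((Fin n → ℝ) → ℝ) → ((Fin n → ℝ) → ℝ)) : (Fin n → ℝ) → (Fin n → ℝ) :=
  fun z i => σ (LinearMap.proj i : (Fin n → ℝ) →ₗ[ℝ] ℝ) z

theorem map_linear_eq_comp_dualMap
    (hadd : ∀ f ∈ Afree n, ∀ g ∈ Afree n, σ (f + g) = σ f + σ g)
    {L : (Fin n → ℝ) →ₗ[ℝ] ℝ} (hL : IsHomLinZ L) : σ L = L ∘ dualMap σ := by
  obtain ⟨c, hc⟩ := hL
  let τ : afreeAddSubgroup n →+ ((Fin n → ℝ) → ℝ) :=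
    AddMonoidHom.mk' (fun f => σ f) fun f g => hadd f f.2 g g.2
  let π : Fin n → afreeAddSubgroup n := fun i =>
    ⟨(LinearMap.proj i : (Fin n → ℝ) →ₗ[ℝ] ℝ), linearMap_mem_Afree (isHomLinZ_proj i)⟩
  have hLπ : ⇑L = ((∑ i, c i • π i : afreeAddSubgroup n) : (Fin n → ℝ) → ℝ) := by
    ext x
    simp [hc, π]
  have hτ : σ L = τ (∑ i, c i • π i) := congrArg σ hLπ
  ext z
  rw [hτ, map_sum, Function.comp_apply, hc, Finset.sum_apply]
  refine Finset.sum_congr rfl fun i _ => ?_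
  rw [map_zsmul, Pi.smul_apply, zsmul_eq_mul]
  rfl

/-- Each `f ∈ A_n` dominates meets of linear functions that touch it at a prescribed point; as `σ`
is composition with its dual on such meets, `σ f ≥ f ∘ dualMap σ`. -/
theorem comp_dualMap_le (hadd : ∀ f ∈ Afree n, ∀ g ∈ Afree n, σ (f + g) = σ f + σ g)
    (hinf : ∀ f ∈ Afree n, ∀ g ∈ Afree n, σ (f ⊓ g) = σ f ⊓ σ g)
    {f : (Fin n → ℝ) → ℝ} (hf : f ∈ Afree n) : f ∘ dualMap σ ≤ σ f := by
  intro z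
  obtain ⟨hfc, s, hs, hsZ, hfs⟩ := mem_Afree_iff.1 hf
  set x := dualMap σ z with hx
  have htfin : {L ∈ s | f x ≤ L x}.Finite := hs.subset (Set.sep_subset _ _)
  have hne : htfin.toFinset.Nonempty := by
    obtain ⟨L, hL, h⟩ := hfs x
    exact ⟨L, by simpa using ⟨hL, h.le⟩⟩
  set g : (Fin n → ℝ) → ℝ := htfin.toFinset.inf' hne fun L => ⇑L with hg
  have hgσ : g ∈ Afree n ∧ σ g = g ∘ dualMap σ := by
    refine Finset.inf'_induction (p := fun g => g ∈ Afree n ∧ σ g = g ∘ dualMap σ) hne _ ?_ ?_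
    · rintro g₁ ⟨h₁, e₁⟩ g₂ ⟨h₂, e₂⟩
      exact ⟨inf_mem_Afree h₁ h₂, by rw [hinf _ h₁ _ h₂, e₁, e₂]; rfl⟩
    · intro L hL
      have hLs : L ∈ s := by simp at hL; exact hL.1
      exact ⟨linearMap_mem_Afree (hsZ L hLs), map_linear_eq_comp_dualMap hadd (hsZ L hLs)⟩
  have hgf : g ≤ f := by
    intro y
    obtain ⟨L, hL, hLx, hLy⟩ := exists_le_and_le_of_selection hfc hs hfs x y
    exact ((Finset.inf'_le (fun L : (Fin n → ℝ) →ₗ[ℝ] ℝ => ⇑L)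
      (by simpa using ⟨hL, hLx⟩ : L ∈ htfin.toFinset)) y).trans hLy
  have hfg : f x ≤ g x := by
    rw [hg, Finset.inf'_apply]
    refine Finset.le_inf' _ _ fun L hL => ?_
    simp at hL
    exact hL.2
  calc f x ≤ g x := hfg
    _ = σ g z := (congrFun hgσ.2 z).symm
    _ ≤ σ f z := by
      have h := hinf g hgσ.1 f hf
      rw [inf_eq_left.2 hgf] at h
      exact (inf_eq_left.1 h.symm) z

theorem map_eq_comp_dualMap (hadd : ∀ f ∈ Afree n, ∀ g ∈ Afree n, σ (f + g) = σ f + σ g)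
    (hinf : ∀ f ∈ Afree n, ∀ g ∈ Afree n, σ (f ⊓ g) = σ f ⊓ σ g)
    {f : (Fin n → ℝ) → ℝ} (hf : f ∈ Afree n) : σ f = f ∘ dualMap σ := by
  refine le_antisymm (fun z => ?_) (comp_dualMap_le hadd hinf hf)
  have h := comp_dualMap_le hadd hinf ((afreeAddSubgroup n).neg_mem hf) z
  rw [map_neg_of_map_add hadd hf] at h
  simpa using h

theorem isPiecewiseLinear_dualMap (hmaps : Set.MapsTo σ (Afree n) (Afree n)) :
    IsPiecewiseLinear (dualMap σ) := by
  have h := fun i => mem_Afree_iff.1 (hmaps (linearMap_mem_Afree (isHomLinZ_proj (n := n) i)))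
  choose hc s hs _ hsel using h
  refine ⟨continuous_pi hc, LinearMap.pi '' Set.univ.pi s,
    (Set.Finite.pi fun i => hs i).image _, fun x => ?_⟩
  choose L hL hx using fun i => hsel i x
  exact ⟨LinearMap.pi L, ⟨L, fun i _ => hL i, rfl⟩, funext hx⟩

end Endomorphism

/-- for all `n ≥ 1`, the free `n`-generator ℓ-group `A_n` is hopfian: every
surjective ℓ-endomorphism of `A_n` is injective. -/
theorem stmt18 {n : ℕ} (hn : 1 ≤ n) :
    ∀ σ : ((Fin n → ℝ) → ℝ) → ((Fin n → ℝ) → ℝ),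
      Set.MapsTo σ (Afree n) (Afree n) →
      (∀ f ∈ Afree n, ∀ g ∈ Afree n, σ (f + g) = σ f + σ g) →
      (∀ f ∈ Afree n, ∀ g ∈ Afree n, σ (f ⊔ g) = σ f ⊔ σ g) →
      (∀ f ∈ Afree n, ∀ g ∈ Afree n, σ (f ⊓ g) = σ f ⊓ σ g) →
      Set.SurjOn σ (Afree n) (Afree n) → Set.InjOn σ (Afree n) := by
  intro σ hmaps hadd _ hinf hsurj
  have hdual : Function.Injective (dualMap σ) := by
    intro z w hzw
    ext i
    obtain ⟨f, hf, hfi⟩ := hsurj (linearMap_mem_Afree (isHomLinZ_proj (n := n) i))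
    rw [map_eq_comp_dualMap hadd hinf hf] at hfi
    calc z i = f (dualMap σ z) := (congrFun hfi z).symm
      _ = f (dualMap σ w) := by rw [hzw]
      _ = w i := congrFun hfi w
  intro f hf g hg hfg
  rw [map_eq_comp_dualMap hadd hinf hf, map_eq_comp_dualMap hadd hinf hg] at hfg
  exact ((isPiecewiseLinear_dualMap hmaps).surjective_of_injective hdual).injective_comp_right hfg
end

section
/- Let Q = {(x, y) ∈ ℝ² : x ≥ 0, y ≥ 0} and let A_2↾Q = {f↾Q : f ∈ A_2}, an abelian group under pointwise addition and a lattice under pointwise ∨ and ∧. Then A_2↾Q is not hopfian: the map σ(f) = f ∘ q, where q(x, y) = (x, x + y), is a surjective ℓ-endomorphism of A_2↾Q whose kernel contains the nonzero function (x, y) ↦ max(x − y, 0). Equivalently, the quotient ℓ-group A_2/𝔮, where 𝔮 = {f ∈ A_2 : f vanishes identically on Q}, is not hopfian. -/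
open Set

/-- `A₂↾Q`: restrictions to the quadrant `Q` of elements of `A₂`. -/
def A2resQ : Set (↥Qset → ℝ) := {g : ↥Qset → ℝ | ∃ f ∈ A2, ∀ v : ↥Qset, g v = f v.1}

/-- A homogeneous linear integer polynomial composed with the shear `(x, y) ↦ (x, c x + y)`,
`c ∈ ℤ`, is again one. -/
theorem IsHomLinZ2.comp_shear {p : ℝ × ℝ → ℝ} (hp : IsHomLinZ2 p) (c : ℤ) :
    IsHomLinZ2 (fun v => p (v.1, c * v.1 + v.2)) := by
  obtain ⟨a, b, h⟩ := hp
  refine ⟨a + b * c, b, fun v => ?_⟩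
  simp only [h]
  push_cast
  ring

/-- `A₂` is closed under composition with the integer shears `(x, y) ↦ (x, c x + y)`. -/
theorem A2.comp_shear {f : ℝ × ℝ → ℝ} (hf : f ∈ A2) (c : ℤ) :
    (fun v : ℝ × ℝ => f (v.1, c * v.1 + v.2)) ∈ A2 := by
  obtain ⟨hc, u, p, hp, h⟩ := hf
  exact ⟨hc.comp (by fun_prop), u, fun j v => p j (v.1, c * v.1 + v.2),
    fun j => (hp j).comp_shear c, fun v => h _⟩

theorem zero_mem_A2resQ : (0 : ↥Qset → ℝ) ∈ A2resQ :=
  ⟨fun _ => 0, ⟨continuous_const, 1, fun _ _ => 0, fun _ => ⟨0, 0, by simp⟩, fun _ => ⟨0, rfl⟩⟩,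
    fun _ => rfl⟩

theorem max_sub_zero_mem_A2 : (fun v : ℝ × ℝ => max (v.1 - v.2) 0) ∈ A2 := by
  refine ⟨by fun_prop, 2, ![fun v => v.1 - v.2, fun _ => 0], ?_, fun v => ?_⟩
  · rw [Fin.forall_fin_two]
    exact ⟨⟨1, -1, fun v => by simp [sub_eq_add_neg]⟩, ⟨0, 0, fun v => by simp⟩⟩
  · rcases max_choice (v.1 - v.2) 0 with h | h
    · exact ⟨0, h⟩
    · exact ⟨1, h⟩

/-- the ℓ-group `A₂↾Q` (equivalently, the quotient `A₂/𝔮` by the ideal of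
functions vanishing on `Q`) is not hopfian: `σ(f) = f ∘ q` with `q(x,y) = (x, x+y)` is a
surjective ℓ-endomorphism of `A₂↾Q` whose kernel contains the nonzero function
`(x,y) ↦ max (x - y) 0`. -/
theorem stmt19 :
    Set.MapsTo (fun g : ↥Qset → ℝ => g ∘ qmapQ) A2resQ A2resQ ∧
    (∀ f ∈ A2resQ, ∀ g ∈ A2resQ, (f + g) ∘ qmapQ = f ∘ qmapQ + g ∘ qmapQ) ∧
    (∀ f ∈ A2resQ, ∀ g ∈ A2resQ, (f ⊔ g) ∘ qmapQ = f ∘ qmapQ ⊔ g ∘ qmapQ) ∧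
    (∀ f ∈ A2resQ, ∀ g ∈ A2resQ, (f ⊓ g) ∘ qmapQ = f ∘ qmapQ ⊓ g ∘ qmapQ) ∧
    Set.SurjOn (fun g : ↥Qset → ℝ => g ∘ qmapQ) A2resQ A2resQ ∧
    ((fun v : ↥Qset => max (v.1.1 - v.1.2) 0) ∈ A2resQ) ∧
    (fun v : ↥Qset => max (v.1.1 - v.1.2) 0) ≠ (0 : ↥Qset → ℝ) ∧
    (fun v : ↥Qset => max (v.1.1 - v.1.2) 0) ∘ qmapQ = (0 : ↥Qset → ℝ) ∧
    ¬ Set.InjOn (fun g : ↥Qset → ℝ => g ∘ qmapQ) A2resQ := by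
  have hmem : (fun v : ↥Qset => max (v.1.1 - v.1.2) 0) ∈ A2resQ :=
    ⟨_, max_sub_zero_mem_A2, fun _ => rfl⟩
  have hne : (fun v : ↥Qset => max (v.1.1 - v.1.2) 0) ≠ (0 : ↥Qset → ℝ) := by
    intro h
    have := congrFun h ⟨(1, 0), by simp [Qset]⟩
    norm_num at this
  have hker : (fun v : ↥Qset => max (v.1.1 - v.1.2) 0) ∘ qmapQ = (0 : ↥Qset → ℝ) := by
    funext v
    have := v.2.2
    simpa [qmapQ] using this
  refine ⟨?_, fun _ _ _ _ => rfl, fun _ _ _ _ => rfl, fun _ _ _ _ => rfl, ?_, hmem, hne, hker,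
    fun hinj => hne (hinj hmem zero_mem_A2resQ hker)⟩
  · rintro g ⟨f, hf, hg⟩
    exact ⟨_, A2.comp_shear hf 1, fun v => by simp [hg, qmapQ]⟩
  · rintro g ⟨f, hf, hg⟩
    exact ⟨_, ⟨_, A2.comp_shear hf (-1), fun _ => rfl⟩, funext fun v => by simp [hg, qmapQ]⟩
end
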